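/- Let p ∈ ℕ and α₀, …, α_p ∈ ℝ be such that the (p+1)×(p+1) Toeplitz matrix K_{p+1} with Row-ℓ Column-m entry α_{|ℓ−m|} is positive definite, let K_p be its top-left p×p submatrix, and set σ² = det K_{p+1} / det K_p. Let α > 1. Then the supremum, over all one-sided stochastic processes (X_i)_{i∈ℕ} satisfying E[X_i X_{i+k}] = α_k for every i ∈ ℕ and every k ∈ {0, …, p} and whose order-α Rényi rate is defined, of the order-α Rényi rate equals (1/2)·log(2πe σ²), the Shannon entropy rate of the p-th order Gauss–Markov process satisfying these constraints. -/

import Mathlib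

open MeasureTheory ENNReal Filter

noncomputable section

/-- `f` is a probability density (w.r.t. Lebesgue measure) on `ℝⁿ`. -/
def IsDensity {n : ℕ} (f : (Fin n → ℝ) → ℝ) : Prop :=
  Measurable f ∧ (∀ x, 0 ≤ f x) ∧ ∫⁻ x, ENNReal.ofReal (f x) = 1

/-- `∫ f(x)^α dx`, as an extended nonnegative real. -/
def renyiIntegral {n : ℕ} (f : (Fin n → ℝ) → ℝ) (α : ℝ) : ℝ≥0∞ :=
  ∫⁻ x, ENNReal.ofReal (f x ^ α)

/-- Order-`α` Rényi entropy of a density on `ℝⁿ`: `(1/(1-α)) log ∫ f^α`, interpreted as `+∞`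
if the integral diverges and `α < 1`, and as `-∞` if it diverges and `α > 1`. -/
def renyiEntropy {n : ℕ} (f : (Fin n → ℝ) → ℝ) (α : ℝ) : EReal :=
  if renyiIntegral f α = ∞ then (if α < 1 then (⊤ : EReal) else (⊥ : EReal))
  else (((1 - α)⁻¹ * Real.log (renyiIntegral f α).toReal : ℝ) : EReal)

/-- The first `n` coordinates `(X₁, …, X_n)` of a one-sided path. -/
def nvec (n : ℕ) : (ℕ → ℝ) → (Fin n → ℝ) := fun ω i => ω i

/-- `F n` is a probability density of the random vector `(X₁, …, X_n)` under `μ`,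
for every `n`. -/
def HasDensityFamilyNat (μ : Measure (ℕ → ℝ)) (F : (n : ℕ) → (Fin n → ℝ) → ℝ) : Prop :=
  ∀ n, IsDensity (F n) ∧
    Measure.map (nvec n) μ = volume.withDensity (fun x => ENNReal.ofReal (F n x))

/-- The order-`α` Rényi rate of a process whose `n`-dimensional marginal densities are
`F n` is defined and equals `L`, i.e. `(1/n)·h_α(F n) → L`. -/
def HasRenyiRate (F : (n : ℕ) → (Fin n → ℝ) → ℝ) (α : ℝ) (L : EReal) : Prop :=
  Tendsto (fun n : ℕ => (((n : ℝ)⁻¹ : ℝ) : EReal) * renyiEntropy (F n) α) atTop (nhds L)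

/-- The process `(X_i)_{i∈ℕ}` with law `μ` satisfies the autocovariance constraints
`E[X_i X_{i+k}] = a k` for every `i` and every `k ∈ {0, …, p}`. -/
def SatisfiesBurgConstraints (μ : Measure (ℕ → ℝ)) (p : ℕ) (a : ℕ → ℝ) : Prop :=
  ∀ i : ℕ, ∀ k ≤ p, Integrable (fun ω => ω i * ω (i + k)) μ ∧
    ∫ ω, ω i * ω (i + k) ∂μ = a k

/-- The `(p+1) × (p+1)` Toeplitz matrix whose Row-`ℓ` Column-`m` entry is `a |ℓ - m|`. -/
def toeplitz (p : ℕ) (a : ℕ → ℝ) : Matrix (Fin (p + 1)) (Fin (p + 1)) ℝ :=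
  Matrix.of fun ℓ m => a ((ℓ : ℤ) - (m : ℤ)).natAbs

/-- The top-left `p × p` submatrix of the Toeplitz matrix. -/
def toeplitzSub (p : ℕ) (a : ℕ → ℝ) : Matrix (Fin p) (Fin p) ℝ :=
  Matrix.of fun ℓ m => a ((ℓ : ℤ) - (m : ℤ)).natAbs

theorem toeplitz_posDef_of_le {p q : ℕ} {a : ℕ → ℝ} (h : (toeplitz p a).PosDef) (hq : q ≤ p) :
    (toeplitz q a).PosDef := by
  have := h.submatrix (e := Fin.castLE (Nat.succ_le_succ hq)) (Fin.castLE_injective _)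
  exact this

theorem toeplitz_submatrix_succ (q : ℕ) (a : ℕ → ℝ) :
    (toeplitz q a).submatrix Fin.succ Fin.succ = toeplitzSub q a := by
  ext i j
  simp [toeplitz, toeplitzSub]

theorem toeplitzSub_posDef {q : ℕ} {a : ℕ → ℝ} (h : (toeplitz q a).PosDef) :
    (toeplitzSub q a).PosDef := by
  rw [← toeplitz_submatrix_succ]
  exact h.submatrix (Fin.succ_injective _)

/-- The prediction error variance `det K_{q+1} / det K_q`. -/
def predVar (q : ℕ) (a : ℕ → ℝ) : ℝ := (toeplitz q a).det / (toeplitzSub q a).det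

theorem predVar_pos {q : ℕ} {a : ℕ → ℝ} (h : (toeplitz q a).PosDef) : 0 < predVar q a :=
  div_pos h.det_pos (toeplitzSub_posDef h).det_pos

/-- Existence of the coefficients of the prediction error filter (Yule–Walker equations). -/
theorem exists_predictionFilter {q : ℕ} {a : ℕ → ℝ} (h : (toeplitz q a).PosDef) :
    ∃ b : ℕ → ℝ, b 0 = 1 ∧ ∀ i ≤ q,
      ∑ j ∈ Finset.range (q + 1), b j * a ((i : ℤ) - (j : ℤ)).natAbs =
        if i = 0 then predVar q a else 0 := by
  set K := toeplitz q a with hK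
  have hdet : K.det ≠ 0 := h.det_pos.ne'
  have hsub : (toeplitzSub q a).det ≠ 0 := (toeplitzSub_posDef h).det_pos.ne'
  have hadj : K.adjugate 0 0 = (toeplitzSub q a).det := by
    rw [Matrix.adjugate_fin_succ_eq_det_submatrix]
    simp [hK, toeplitz_submatrix_succ]
  refine ⟨fun j => if hj : j < q + 1 then
    K.adjugate ⟨j, hj⟩ 0 / (toeplitzSub q a).det else 0, ?_, ?_⟩
  · have : (⟨0, Nat.succ_pos q⟩ : Fin (q + 1)) = 0 := rfl
    simp [this, hadj, hsub]
  · intro i hi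
    have key := congrFun (congrFun (Matrix.mul_adjugate K) ⟨i, Nat.lt_succ_of_le hi⟩) 0
    rw [Matrix.mul_apply, Matrix.smul_apply, Matrix.one_apply] at key
    rw [Finset.sum_range]
    have : ∀ j : Fin (q + 1), (if hj : (j : ℕ) < q + 1 then
        K.adjugate ⟨j, hj⟩ 0 / (toeplitzSub q a).det else 0) *
          a ((i : ℤ) - ((j : ℕ) : ℤ)).natAbs =
        K ⟨i, Nat.lt_succ_of_le hi⟩ j * K.adjugate j 0 / (toeplitzSub q a).det := by
      intro j
      simp only [j.2, dite_true, hK, toeplitz, Matrix.of_apply]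
      ring
    rw [Finset.sum_congr rfl fun j _ => this j, ← Finset.sum_div, key]
    by_cases hi0 : i = 0
    · subst hi0
      have : (⟨0, Nat.lt_succ_of_le hi⟩ : Fin (q + 1)) = 0 := rfl
      simp [this, predVar, hK]
    · have : (⟨i, Nat.lt_succ_of_le hi⟩ : Fin (q + 1)) ≠ 0 := by
        intro hh; exact hi0 (by simpa using congrArg Fin.val hh)
      simp [this, hi0]

/-- The coefficients at lags `0, 1, …` of the prediction error filter at time `k`, which looks
back `min k p` steps. -/
theorem exists_filterFamily {p : ℕ} {a : ℕ → ℝ} (h : (toeplitz p a).PosDef) :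
    ∃ b : ℕ → ℕ → ℝ, (∀ k, b k 0 = 1) ∧ (∀ k j, min k p < j → b k j = 0) ∧
      ∀ k, ∀ i ≤ min k p, ∑ j ∈ Finset.range (min k p + 1), b k j * a ((i : ℤ) - (j : ℤ)).natAbs =
        if i = 0 then predVar (min k p) a else 0 := by
  have hex := fun k : ℕ => exists_predictionFilter (toeplitz_posDef_of_le h (min_le_right k p))
  choose b hb0 hb using hex
  refine ⟨fun k j => if j ≤ min k p then b k j else 0, fun k => by simp [hb0],
    fun k j hj => if_neg hj.not_ge, fun k i hi => ?_⟩
  rw [← hb k i hi]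
  refine Finset.sum_congr rfl fun j hj => ?_
  simp only [if_pos (Nat.lt_succ_iff.mp (Finset.mem_range.mp hj))]

theorem exp_integral_mul_le_integral_rpow {Ω : Type*} {mΩ : MeasurableSpace Ω} {τ : Measure Ω}
    {f l : Ω → ℝ} {α : ℝ} (hα : 1 < α) (hf0 : ∀ x, 0 ≤ f x) (hf : Integrable f τ)
    (hf1 : ∫ x, f x ∂τ = 1) (he : Integrable (fun x => Real.exp (l x)) τ)
    (he1 : ∫ x, Real.exp (l x) ∂τ ≤ 1) (hfl : Integrable (fun x => f x * l x) τ)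
    (hfa : Integrable (fun x => f x ^ α) τ) :
    Real.exp ((α - 1) * ∫ x, f x * l x ∂τ) ≤ ∫ x, f x ^ α ∂τ := by
  set c := (α - 1) * ∫ x, f x * l x ∂τ with hc
  have hpt : ∀ x, (1 - c) * f x + (α - 1) * (f x * l x + f x - Real.exp (l x)) ≤
      f x ^ α * Real.exp (-c) := by
    intro x
    rcases (hf0 x).eq_or_lt with h0 | h0
    · rw [← h0, Real.zero_rpow (by linarith)]
      nlinarith [Real.exp_pos (l x)]
    · have h1 : f x ^ α * Real.exp (-c) = f x * Real.exp ((α - 1) * Real.log (f x) - c) := by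
        rw [Real.rpow_def_of_pos h0, ← Real.exp_add]
        nth_rewrite 2 [← Real.exp_log h0]
        rw [← Real.exp_add]; ring_nf
      have h2 : Real.exp (l x) = f x * Real.exp (l x - Real.log (f x)) := by
        rw [Real.exp_sub, Real.exp_log h0]; field_simp
      have h3 := mul_le_mul_of_nonneg_left
        (Real.add_one_le_exp ((α - 1) * Real.log (f x) - c)) h0.le
      have h4 := mul_le_mul_of_nonneg_left (Real.add_one_le_exp (l x - Real.log (f x))) h0.le
      rw [← h2] at h4
      have h5 := mul_le_mul_of_nonneg_left h4 (sub_pos.2 hα).le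
      rw [h1]
      linarith
  have hfs : Integrable (fun x => f x * l x + f x) τ := hfl.add hf
  have hg : Integrable (fun x => f x * l x + f x - Real.exp (l x)) τ := hfs.sub he
  have hint := integral_mono ((hf.const_mul (1 - c)).add (hg.const_mul (α - 1)))
    (hfa.mul_const (Real.exp (-c))) hpt
  simp only [Pi.add_apply] at hint
  rw [integral_add (hf.const_mul _) (hg.const_mul _), integral_const_mul, integral_const_mul,
    integral_mul_const, integral_sub hfs he, integral_add hfl hf, hf1] at hint
  have h6 : 1 ≤ (∫ x, f x ^ α ∂τ) * Real.exp (-c) := by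
    nlinarith
  rw [Real.exp_neg, ← div_eq_mul_inv, le_div_iff₀ (Real.exp_pos c)] at h6
  linarith

theorem IsDensity.integrable {n : ℕ} {f : (Fin n → ℝ) → ℝ} (hf : IsDensity f) : Integrable f := by
  refine ⟨hf.1.aestronglyMeasurable, ?_⟩
  rw [hasFiniteIntegral_iff_ofReal (Eventually.of_forall hf.2.1), hf.2.2]
  exact one_lt_top

theorem IsDensity.integral_eq_one {n : ℕ} {f : (Fin n → ℝ) → ℝ} (hf : IsDensity f) :
    ∫ x, f x = 1 := by
  rw [integral_eq_lintegral_of_nonneg_ae (Eventually.of_forall hf.2.1)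
    hf.1.aestronglyMeasurable, hf.2.2, toReal_one]

/-- Comparison of the Rényi entropy of order `α > 1` with the cross-entropy. -/
theorem renyiEntropy_le_crossEntropy {n : ℕ} {f l : (Fin n → ℝ) → ℝ} {α : ℝ} (hα : 1 < α)
    (hf : IsDensity f) {S : Set (Fin n → ℝ)} (hfS : ∫ x in S, f x = 1)
    (he : IntegrableOn (fun x => Real.exp (l x)) S) (he1 : ∫ x in S, Real.exp (l x) ≤ 1)
    (hfl : IntegrableOn (fun x => f x * l x) S) :
    renyiEntropy f α ≤ ((-∫ x in S, f x * l x : ℝ) : EReal) := by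
  unfold renyiEntropy
  split_ifs with h1 h2
  · linarith
  · exact bot_le
  · have hfa0 : ∀ x, 0 ≤ f x ^ α := fun x => Real.rpow_nonneg (hf.2.1 x) α
    have hfam : AEStronglyMeasurable (fun x => f x ^ α) volume :=
      (hf.1.pow_const α).aestronglyMeasurable
    have hfa : Integrable (fun x => f x ^ α) := by
      refine ⟨hfam, ?_⟩
      rw [hasFiniteIntegral_iff_ofReal (Eventually.of_forall hfa0)]
      exact lt_top_iff_ne_top.2 h1
    have hI : (renyiIntegral f α).toReal = ∫ x, f x ^ α :=
      (integral_eq_lintegral_of_nonneg_ae (Eventually.of_forall hfa0) hfam).symm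
    have hle : Real.exp ((α - 1) * ∫ x in S, f x * l x) ≤ ∫ x, f x ^ α :=
      (exp_integral_mul_le_integral_rpow hα hf.2.1 hf.integrable.integrableOn hfS he he1 hfl
        hfa.integrableOn).trans
        (setIntegral_le_integral hfa (Eventually.of_forall hfa0))
    rw [hI, EReal.coe_le_coe_iff]
    have hlog := (Real.le_log_iff_exp_le ((Real.exp_pos _).trans_le hle)).2 hle
    have hα' : 0 < α - 1 := sub_pos.2 hα
    have : (1 - α)⁻¹ = -(α - 1)⁻¹ := by rw [← inv_neg]; ring_nf
    rw [this, neg_mul, neg_le_neg_iff, le_inv_mul_iff₀ hα']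
    exact hlog

theorem neg_log_le_renyiEntropy {n : ℕ} {f : (Fin n → ℝ) → ℝ} {α c : ℝ} (hα : 1 < α)
    (hf : IsDensity f) (hc : 0 < c) (hfc : ∀ᵐ x, f x ≤ c) :
    ((-Real.log c : ℝ) : EReal) ≤ renyiEntropy f α := by
  have hα' : 0 < α - 1 := sub_pos.2 hα
  have hle : renyiIntegral f α ≤ ENNReal.ofReal (c ^ (α - 1)) := by
    calc renyiIntegral f α ≤ ∫⁻ x, ENNReal.ofReal (c ^ (α - 1)) * ENNReal.ofReal (f x) := by
          refine lintegral_mono_ae (hfc.mono fun x hx => ?_)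
          rw [← ENNReal.ofReal_mul (Real.rpow_nonneg hc.le _)]
          refine ENNReal.ofReal_le_ofReal ?_
          have : f x ^ α = f x ^ (α - 1) * f x := by
            rcases (hf.2.1 x).eq_or_lt with h0 | h0
            · rw [← h0, Real.zero_rpow (by linarith), mul_zero]
            · nth_rewrite 3 [← Real.rpow_one (f x)]
              rw [← Real.rpow_add h0]; ring_nf
          rw [this]
          exact mul_le_mul_of_nonneg_right (Real.rpow_le_rpow (hf.2.1 x) hx hα'.le) (hf.2.1 x)
      _ = ENNReal.ofReal (c ^ (α - 1)) := by
          rw [lintegral_const_mul _ hf.1.ennreal_ofReal, hf.2.2, mul_one]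
  have hne0 : renyiIntegral f α ≠ 0 := by
    intro h0
    unfold renyiIntegral at h0
    rw [lintegral_eq_zero_iff (hf.1.pow_const α).ennreal_ofReal] at h0
    have : ∫⁻ x, ENNReal.ofReal (f x) = 0 := by
      rw [lintegral_eq_zero_iff hf.1.ennreal_ofReal]
      refine h0.mono fun x hx => ?_
      simp only [Pi.zero_apply, ENNReal.ofReal_eq_zero] at hx ⊢
      by_contra hpos
      exact hx.not_gt (Real.rpow_pos_of_pos (not_le.1 hpos) α)
    rw [hf.2.2] at this
    exact one_ne_zero this
  have hnetop : renyiIntegral f α ≠ ∞ := (hle.trans_lt ofReal_lt_top).ne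
  rw [renyiEntropy, if_neg hnetop, EReal.coe_le_coe_iff]
  have hlog : Real.log (renyiIntegral f α).toReal ≤ (α - 1) * Real.log c := by
    rw [← Real.log_rpow hc]
    exact Real.log_le_log (ENNReal.toReal_pos hne0 hnetop)
      (ENNReal.toReal_le_of_le_ofReal (Real.rpow_nonneg hc.le _) hle)
  have : (1 - α)⁻¹ = -(α - 1)⁻¹ := by rw [← inv_neg]; ring_nf
  rw [this, neg_mul, neg_le_neg_iff, inv_mul_le_iff₀ hα']
  exact hlog

theorem renyiEntropy_le_log_volume {n : ℕ} {f : (Fin n → ℝ) → ℝ} {α s : ℝ} (hα : 1 < α)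
    (hf : IsDensity f) {S : Set (Fin n → ℝ)} (hfS : ∫ x in S, f x = 1)
    (hs : 0 < s) (hS : volume S ≤ ENNReal.ofReal s) :
    renyiEntropy f α ≤ ((Real.log s : ℝ) : EReal) := by
  have hfin : volume S ≠ ∞ := (hS.trans_lt ofReal_lt_top).ne
  have h := renyiEntropy_le_crossEntropy (l := fun _ => -Real.log s) hα hf hfS
    (integrableOn_const hfin) ?_ (hf.integrable.integrableOn.mul_const _)
  · rw [integral_mul_const, hfS] at h
    simpa using h
  · rw [setIntegral_const, Real.exp_neg, Real.exp_log hs, smul_eq_mul, ← div_eq_mul_inv,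
      div_le_one hs]
    exact ENNReal.toReal_le_of_le_ofReal hs.le hS

/-- A law dominated by a multiple of Lebesgue measure has a bounded density, whose Rényi entropies
are controlled by the bound and by the volume of a set of full measure. -/
theorem exists_density_renyiEntropy_bounds {n : ℕ} {ν : Measure (Fin n → ℝ)}
    [IsProbabilityMeasure ν] {c : ℝ} (hc : 0 < c) (hν : ν ≤ ENNReal.ofReal c • volume) :
    ∃ f : (Fin n → ℝ) → ℝ, IsDensity f ∧
      ν = volume.withDensity (fun x => ENNReal.ofReal (f x)) ∧
      ∀ α, 1 < α → ((-Real.log c : ℝ) : EReal) ≤ renyiEntropy f α ∧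
        ∀ S : Set (Fin n → ℝ), MeasurableSet S → ν S = 1 → ∀ s, 0 < s →
          volume S ≤ ENNReal.ofReal s → renyiEntropy f α ≤ ((Real.log s : ℝ) : EReal) := by
  have hac : ν ≪ volume :=
    (Measure.absolutelyContinuous_of_le hν).trans (Measure.smul_absolutelyContinuous)
  have hwd : volume.withDensity (ν.rnDeriv volume) = ν := Measure.withDensity_rnDeriv_eq _ _ hac
  have hlt : ∀ᵐ x, ν.rnDeriv volume x < ∞ := Measure.rnDeriv_lt_top ν volume
  have hae : (fun x => ENNReal.ofReal (ν.rnDeriv volume x).toReal) =ᵐ[volume]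
      ν.rnDeriv volume := hlt.mono fun x hx => ENNReal.ofReal_toReal hx.ne
  have hwd' : ν = volume.withDensity
      (fun x => ENNReal.ofReal (ν.rnDeriv volume x).toReal) := by
    rw [withDensity_congr_ae hae, hwd]
  have hdens : IsDensity fun x => (ν.rnDeriv volume x).toReal := by
    refine ⟨(Measure.measurable_rnDeriv _ _).ennreal_toReal, fun x => toReal_nonneg, ?_⟩
    rw [← setLIntegral_univ, ← withDensity_apply _ MeasurableSet.univ, ← hwd', measure_univ]
  have hbd : ∀ᵐ x, (ν.rnDeriv volume x).toReal ≤ c := by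
    have : ν.rnDeriv volume ≤ᵐ[volume] fun _ => ENNReal.ofReal c := by
      refine ae_le_of_forall_setLIntegral_le_of_sigmaFinite (Measure.measurable_rnDeriv _ _) ?_
      intro A hA _
      rw [← withDensity_apply _ hA, hwd, setLIntegral_const]
      simpa using hν A
    exact this.mono fun x hx => ENNReal.toReal_le_of_le_ofReal hc.le hx
  refine ⟨_, hdens, hwd', fun α hα => ⟨neg_log_le_renyiEntropy hα hdens hc hbd,
    fun S hSm hS s hs hvol => renyiEntropy_le_log_volume hα hdens ?_ hs hvol⟩⟩
  rw [integral_eq_lintegral_of_nonneg_ae (Eventually.of_forall fun x => toReal_nonneg)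
    hdens.1.aestronglyMeasurable, ← withDensity_apply _ hSm, ← hwd', hS, toReal_one]

/-- The lower triangular matrix of the causal filter whose coefficient at time `k` and lag `j` is
`b k j`. -/
def lagMatrix (b : ℕ → ℕ → ℝ) (n : ℕ) : Matrix (Fin n) (Fin n) ℝ :=
  Matrix.of fun k l => if l ≤ k then b k (k - l) else 0

theorem det_lagMatrix (b : ℕ → ℕ → ℝ) (n : ℕ) :
    (lagMatrix b n).det = ∏ k : Fin n, b k 0 := by
  rw [Matrix.det_of_isLowerTriangular]
  · simp [lagMatrix]
  · intro i j hij
    simp only [lagMatrix, Matrix.of_apply]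
    rw [if_neg]
    simpa using hij

theorem lagMatrix_mulVec_apply {b : ℕ → ℕ → ℝ} {p n : ℕ} (hb : ∀ k j, min k p < j → b k j = 0)
    (x : ℕ → ℝ) (k : Fin n) :
    ((lagMatrix b n).mulVec fun l : Fin n => x l) k =
      ∑ j ∈ Finset.range (min (k : ℕ) p + 1), b k j * x (k - j) := by
  have hk := k.2
  simp only [Matrix.mulVec, dotProduct, lagMatrix, Matrix.of_apply]
  have h1 : ∑ l : Fin n, (if l ≤ k then b k (k - l) else 0) * x l =
      ∑ l ∈ Finset.range n, (if l ≤ (k : ℕ) then b k (k - l) else 0) * x l := by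
    rw [Finset.sum_range]; rfl
  rw [h1, ← Finset.sum_subset (Finset.range_mono (Nat.succ_le_of_lt hk)),
    ← Finset.sum_range_reflect]
  · symm
    apply Finset.sum_subset_zero_on_sdiff
    · intro j hj
      simp only [Finset.mem_range] at hj ⊢
      omega
    · intro j hj
      simp only [Finset.mem_sdiff, Finset.mem_range] at hj
      have h2 : (k : ℕ) - (k + 1 - 1 - j) = j := by omega
      rw [h2, hb k j (by omega)]
      simp
    · intro j hj
      simp only [Finset.mem_range] at hj
      have h2 : (k : ℕ) - (k + 1 - 1 - j) = j := by omega
      have h3 : (k : ℕ) + 1 - 1 - j = k - j := by omega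
      rw [h2, h3, if_pos (by omega)]
  · intro l _ hl
    simp only [Finset.mem_range] at hl
    rw [if_neg (by omega), zero_mul]

theorem SatisfiesBurgConstraints.lag {μ : Measure (ℕ → ℝ)} {p : ℕ} {a : ℕ → ℝ}
    (h : SatisfiesBurgConstraints μ p a) {k i j : ℕ} (hi : i ≤ min k p) (hj : j ≤ min k p) :
    Integrable (fun ω => ω (k - i) * ω (k - j)) μ ∧
      ∫ ω, ω (k - i) * ω (k - j) ∂μ = a ((i : ℤ) - (j : ℤ)).natAbs := by
  rcases le_total i j with hij | hij
  · have h1 := h (k - j) (j - i) (by omega)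
    have e1 : k - j + (j - i) = k - i := by omega
    have e2 : ((i : ℤ) - (j : ℤ)).natAbs = j - i := by omega
    rw [e1] at h1
    simp_rw [mul_comm _ (_ : ℝ)] at h1 ⊢
    rw [e2]
    simpa [mul_comm] using h1
  · have h1 := h (k - i) (i - j) (by omega)
    have e1 : k - i + (i - j) = k - j := by omega
    have e2 : ((i : ℤ) - (j : ℤ)).natAbs = i - j := by omega
    rw [e1] at h1
    rwa [e2]

/-- The prediction error filter has output variance `predVar`. -/
theorem SatisfiesBurgConstraints.filter_sq {μ : Measure (ℕ → ℝ)} {p : ℕ} {a : ℕ → ℝ}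
    (h : SatisfiesBurgConstraints μ p a) {b : ℕ → ℕ → ℝ} (hb0 : ∀ k, b k 0 = 1)
    (hb : ∀ k, ∀ i ≤ min k p,
      ∑ j ∈ Finset.range (min k p + 1), b k j * a ((i : ℤ) - (j : ℤ)).natAbs =
        if i = 0 then predVar (min k p) a else 0) (k : ℕ) :
    Integrable (fun ω => (∑ j ∈ Finset.range (min k p + 1), b k j * ω (k - j)) ^ 2) μ ∧
      ∫ ω, (∑ j ∈ Finset.range (min k p + 1), b k j * ω (k - j)) ^ 2 ∂μ =
        predVar (min k p) a := by
  have hexp : ∀ ω : ℕ → ℝ, (∑ j ∈ Finset.range (min k p + 1), b k j * ω (k - j)) ^ 2 =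
      ∑ i ∈ Finset.range (min k p + 1), ∑ j ∈ Finset.range (min k p + 1),
        b k i * b k j * (ω (k - i) * ω (k - j)) := by
    intro ω
    rw [sq, Finset.sum_mul_sum]
    refine Finset.sum_congr rfl fun i _ => Finset.sum_congr rfl fun j _ => ?_
    ring
  have hlag : ∀ i ∈ Finset.range (min k p + 1), ∀ j ∈ Finset.range (min k p + 1),
      Integrable (fun ω : ℕ → ℝ => b k i * b k j * (ω (k - i) * ω (k - j))) μ ∧
        ∫ ω, b k i * b k j * (ω (k - i) * ω (k - j)) ∂μ =
          b k i * (b k j * a ((i : ℤ) - (j : ℤ)).natAbs) := by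
    intro i hi j hj
    have h1 := h.lag (k := k) (i := i) (j := j) (Nat.lt_succ_iff.1 (Finset.mem_range.1 hi))
      (Nat.lt_succ_iff.1 (Finset.mem_range.1 hj))
    exact ⟨h1.1.const_mul _, by rw [integral_const_mul, h1.2]; ring⟩
  simp_rw [hexp]
  refine ⟨integrable_finsetSum _ fun i hi => integrable_finsetSum _ fun j hj =>
    (hlag i hi j hj).1, ?_⟩
  rw [integral_finsetSum _ fun i hi => integrable_finsetSum _ fun j hj => (hlag i hi j hj).1]
  have : ∀ i ∈ Finset.range (min k p + 1),
      ∫ ω, ∑ j ∈ Finset.range (min k p + 1), b k i * b k j * (ω (k - i) * ω (k - j)) ∂μ =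
        b k i * if i = 0 then predVar (min k p) a else 0 := by
    intro i hi
    rw [integral_finsetSum _ fun j hj => (hlag i hi j hj).1,
      Finset.sum_congr rfl fun j hj => (hlag i hi j hj).2, ← Finset.mul_sum,
      hb k i (Nat.lt_succ_iff.1 (Finset.mem_range.1 hi))]
  rw [Finset.sum_congr rfl this]
  simp [hb0]

theorem integral_prod_gaussian_lagMatrix {b : ℕ → ℕ → ℝ} (hb0 : ∀ k, b k 0 = 1) (n : ℕ)
    (v : Fin n → NNReal) (hv : ∀ k, v k ≠ 0) :
    Integrable (fun x : Fin n → ℝ => ∏ k, ProbabilityTheory.gaussianPDFReal 0 (v k)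
      ((lagMatrix b n).mulVec x k)) ∧
    ∫ x : Fin n → ℝ, ∏ k, ProbabilityTheory.gaussianPDFReal 0 (v k)
      ((lagMatrix b n).mulVec x k) = 1 := by
  have hdet : (lagMatrix b n).det = 1 := by rw [det_lagMatrix]; simp [hb0]
  have hmap : Measure.map (Matrix.toLin' (lagMatrix b n)) volume = volume := by
    rw [Real.map_matrix_volume_pi_eq_smul_volume_pi (by rw [hdet]; exact one_ne_zero), hdet]
    simp
  have hmeas : Measurable (Matrix.toLin' (lagMatrix b n)) :=
    (LinearMap.continuous_on_pi _).measurable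
  have hprod : Integrable (fun y : Fin n → ℝ =>
      ∏ k, ProbabilityTheory.gaussianPDFReal 0 (v k) (y k)) :=
    Integrable.fintype_prod fun k => ProbabilityTheory.integrable_gaussianPDFReal 0 (v k)
  constructor
  · rw [← hmap] at hprod
    exact hprod.comp_measurable hmeas
  · have h1 := integral_map (μ := (volume : Measure (Fin n → ℝ))) hmeas.aemeasurable
      (by rw [hmap]; exact hprod.aestronglyMeasurable)
    rw [hmap] at h1
    refine h1.symm.trans ?_
    rw [integral_fintype_prod_volume_eq_prod fun k => ProbabilityTheory.gaussianPDFReal 0 (v k)]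
    exact Finset.prod_eq_one fun k _ => ProbabilityTheory.integral_gaussianPDFReal_eq_one 0 (hv k)

theorem gaussianPDFReal_zero_eq_exp {v : NNReal} (hv : v ≠ 0) (y : ℝ) :
    ProbabilityTheory.gaussianPDFReal 0 v y =
      Real.exp (-(1 / 2 * Real.log (2 * Real.pi * v)) - y ^ 2 / (2 * v)) := by
  have hv' : (0 : ℝ) < v := NNReal.coe_pos.2 (pos_iff_ne_zero.2 hv)
  have h2 : 0 < 2 * Real.pi * v := by positivity
  rw [ProbabilityTheory.gaussianPDFReal, Real.exp_sub, Real.exp_neg, sub_zero, neg_div,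
    Real.exp_neg, div_eq_mul_inv, Real.sqrt_eq_rpow, Real.rpow_def_of_pos h2, mul_comm (1 / 2)]
  simp only [div_eq_mul_inv]

/-- Any finite segment of a process satisfying the constraints has Rényi entropy of order `α > 1`
at most the Shannon entropy of the Gauss–Markov process. -/
theorem renyiEntropy_le_of_satisfiesBurgConstraints {p : ℕ} {a : ℕ → ℝ}
    (hpos : (toeplitz p a).PosDef) {α : ℝ} (hα : 1 < α) {μ : Measure (ℕ → ℝ)}
    [IsProbabilityMeasure μ] (hμ : SatisfiesBurgConstraints μ p a) {n : ℕ}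
    {f : (Fin n → ℝ) → ℝ} (hf : IsDensity f)
    (hfμ : Measure.map (nvec n) μ = volume.withDensity (fun x => ENNReal.ofReal (f x))) :
    renyiEntropy f α ≤ ((∑ k ∈ Finset.range n,
      1 / 2 * Real.log (2 * Real.pi * Real.exp 1 * predVar (min k p) a) : ℝ) : EReal) := by
  obtain ⟨b, hb0, hbz, hb⟩ := exists_filterFamily hpos
  have hd : ∀ k, 0 < predVar (min k p) a := fun k =>
    predVar_pos (toeplitz_posDef_of_le hpos (min_le_right k p))
  set v : Fin n → NNReal := fun k => ⟨predVar (min (k : ℕ) p) a, (hd k).le⟩ with hv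
  have hvpos : ∀ k, (0 : ℝ) < v k := fun k => hd k
  have hv0 : ∀ k, v k ≠ 0 := fun k => (NNReal.coe_pos.1 (hvpos k)).ne'
  set l : (Fin n → ℝ) → ℝ := fun x => ∑ k, (-(1 / 2 * Real.log (2 * Real.pi * v k)) -
    ((lagMatrix b n).mulVec x k) ^ 2 / (2 * v k)) with hl
  have hexp : (fun x => Real.exp (l x)) = fun x : Fin n → ℝ =>
      ∏ k, ProbabilityTheory.gaussianPDFReal 0 (v k) ((lagMatrix b n).mulVec x k) := by
    funext x
    rw [hl, Real.exp_sum]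
    exact Finset.prod_congr rfl fun k _ => (gaussianPDFReal_zero_eq_exp (hv0 k) _).symm
  have hnv : Measurable (nvec n) := measurable_pi_lambda _ fun i => measurable_pi_apply _
  have hlm : Measurable l := by
    have : Continuous l := by
      refine continuous_finsetSum _ fun k _ => ?_
      have : Continuous fun x : Fin n → ℝ => (lagMatrix b n).mulVec x k := by
        simp only [Matrix.mulVec, dotProduct]; fun_prop
      fun_prop
    exact this.measurable
  have hgauss := integral_prod_gaussian_lagMatrix hb0 n v hv0
  have hlω : ∀ ω : ℕ → ℝ, l (nvec n ω) = ∑ k : Fin n, (-(1 / 2 * Real.log (2 * Real.pi * v k)) -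
      (∑ j ∈ Finset.range (min (k : ℕ) p + 1), b k j * ω (k - j)) ^ 2 / (2 * v k)) := by
    intro ω
    refine Finset.sum_congr rfl fun k _ => ?_
    rw [← lagMatrix_mulVec_apply hbz ω k]
    rfl
  have hsq := fun k : Fin n => hμ.filter_sq hb0 hb k
  have hterm : ∀ k : Fin n, Integrable (fun ω => -(1 / 2 * Real.log (2 * Real.pi * v k)) -
      (∑ j ∈ Finset.range (min (k : ℕ) p + 1), b k j * ω (k - j)) ^ 2 / (2 * v k)) μ :=
    fun k => (integrable_const _).sub ((hsq k).1.div_const _)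
  have hlint : Integrable (fun ω => l (nvec n ω)) μ := by
    simp_rw [hlω]
    exact integrable_finsetSum _ fun k _ => hterm k
  have hlmap : Integrable l (Measure.map (nvec n) μ) :=
    (integrable_map_measure hlm.aestronglyMeasurable hnv.aemeasurable).2 hlint
  have hlval : ∫ x, l x ∂(Measure.map (nvec n) μ) = -∑ k ∈ Finset.range n,
      1 / 2 * Real.log (2 * Real.pi * Real.exp 1 * predVar (min k p) a) := by
    rw [integral_map hnv.aemeasurable hlm.aestronglyMeasurable]
    simp_rw [hlω]
    rw [integral_finsetSum _ fun k _ => hterm k, Finset.sum_range, ← Finset.sum_neg_distrib]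
    refine Finset.sum_congr rfl fun k _ => ?_
    rw [integral_sub (integrable_const _) ((hsq k).1.div_const _), integral_div, (hsq k).2]
    have hvk : (v k : ℝ) = predVar (min (k : ℕ) p) a := rfl
    have h2 := hd k
    have h3 : 2 * Real.pi * Real.exp 1 * predVar (min (k : ℕ) p) a =
        Real.exp 1 * (2 * Real.pi * predVar (min (k : ℕ) p) a) := by ring
    rw [hvk, h3, Real.log_mul (Real.exp_pos 1).ne' (by positivity), Real.log_exp]
    simp only [integral_const, probReal_univ, one_smul]
    field_simp
    ring
  have hlt : ∀ᵐ x ∂(volume : Measure (Fin n → ℝ)), ENNReal.ofReal (f x) < ∞ :=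
    Eventually.of_forall fun x => ofReal_lt_top
  have htr : ∀ x, (ENNReal.ofReal (f x)).toReal • l x = f x * l x := fun x => by
    rw [ENNReal.toReal_ofReal (hf.2.1 x), smul_eq_mul]
  rw [hfμ, integral_withDensity_eq_integral_toReal_smul hf.1.ennreal_ofReal hlt] at hlval
  rw [hfμ, integrable_withDensity_iff_integrable_smul' hf.1.ennreal_ofReal hlt] at hlmap
  simp_rw [htr] at hlval hlmap
  have := renyiEntropy_le_crossEntropy (l := l) (S := Set.univ) hα hf
    (by rw [setIntegral_univ]; exact hf.integral_eq_one)
    (by rw [integrableOn_univ, hexp]; exact hgauss.1)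
    (by rw [setIntegral_univ, hexp]; exact hgauss.2.le)
    (by rw [integrableOn_univ]; exact hlmap)
  rwa [setIntegral_univ, hlval, neg_neg] at this

theorem tendsto_inv_mul_sum_predVar (p : ℕ) (φ : ℕ → ℝ) :
    Tendsto (fun n : ℕ => (n : ℝ)⁻¹ * ∑ k ∈ Finset.range n, φ (min k p)) atTop (nhds (φ p)) := by
  refine Tendsto.cesaro (tendsto_const_nhds.congr' ?_)
  filter_upwards [eventually_ge_atTop p] with k hk
  rw [min_eq_right hk]

theorem renyiRate_le {p : ℕ} {a : ℕ → ℝ} (hpos : (toeplitz p a).PosDef) {α : ℝ} (hα : 1 < α)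
    {μ : Measure (ℕ → ℝ)} [IsProbabilityMeasure μ] {F : (n : ℕ) → (Fin n → ℝ) → ℝ} {L : EReal}
    (hμ : SatisfiesBurgConstraints μ p a) (hF : HasDensityFamilyNat μ F)
    (hL : HasRenyiRate F α L) :
    L ≤ ((1 / 2 * Real.log (2 * Real.pi * Real.exp 1 * predVar p a) : ℝ) : EReal) := by
  have hlim := (continuous_coe_real_ereal.tendsto _).comp (tendsto_inv_mul_sum_predVar p
    fun q => 1 / 2 * Real.log (2 * Real.pi * Real.exp 1 * predVar q a))
  refine le_of_tendsto_of_tendsto' hL hlim fun n => ?_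
  have := renyiEntropy_le_of_satisfiesBurgConstraints hpos hα hμ (hF n).1 (hF n).2
  simp only [Function.comp_apply, EReal.coe_mul]
  exact mul_le_mul_of_nonneg_left this (EReal.coe_nonneg.2 (by positivity))

/-- The solution `x` of the recursion `∑ j ≤ k, b k j • x (k - j) = s k • w k`, with `b k 0 = 1`. -/
def arSolution {V : Type*} [AddCommGroup V] [Module ℝ V] (b : ℕ → ℕ → ℝ) (s : ℕ → ℝ) (w : ℕ → V)
    (k : ℕ) : V :=
  s k • w k - ∑ l : Fin k, b k (k - l) • arSolution b s w l
termination_by k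
decreasing_by exact l.2

theorem map_arSolution {V W : Type*} [AddCommGroup V] [Module ℝ V] [AddCommGroup W] [Module ℝ W]
    (φ : V →ₗ[ℝ] W) (b : ℕ → ℕ → ℝ) (s : ℕ → ℝ) (w : ℕ → V) (k : ℕ) :
    φ (arSolution b s w k) = arSolution b s (fun i => φ (w i)) k := by
  induction k using Nat.strong_induction_on with
  | _ k ih =>
    rw [arSolution, arSolution]
    simp only [map_sub, map_smul, map_sum]
    congr 1
    exact Finset.sum_congr rfl fun l _ => by rw [ih l l.2]

theorem arSolution_filter {V : Type*} [AddCommGroup V] [Module ℝ V] {b : ℕ → ℕ → ℝ} {p : ℕ}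
    (hb0 : ∀ k, b k 0 = 1) (hbz : ∀ k j, min k p < j → b k j = 0) (s : ℕ → ℝ) (w : ℕ → V) (k : ℕ) :
    ∑ j ∈ Finset.range (min k p + 1), b k j • arSolution b s w (k - j) = s k • w k := by
  have h1 : ∑ j ∈ Finset.range (min k p + 1), b k j • arSolution b s w (k - j) =
      ∑ j ∈ Finset.range (k + 1), b k j • arSolution b s w (k - j) := by
    apply Finset.sum_subset
    · intro j hj
      simp only [Finset.mem_range] at hj ⊢
      omega
    · intro j _ hj
      simp only [Finset.mem_range] at hj
      rw [hbz k j (by omega), zero_smul]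
  rw [h1, Finset.sum_range_succ', ← Finset.sum_range_reflect, hb0, one_smul, Nat.sub_zero]
  have hk : arSolution b s w k = s k • w k - ∑ l : Fin k, b k (k - l) • arSolution b s w l := by
    rw [arSolution]
  have h2 : ∀ l : Fin k, b k (k - 1 - l + 1) • arSolution b s w (k - (k - 1 - l + 1)) =
      b k (k - l) • arSolution b s w l := by
    intro l
    have hl := l.2
    have e1 : k - 1 - (l : ℕ) + 1 = k - l := by omega
    have e2 : k - (k - (l : ℕ)) = l := by omega
    rw [e1, e2]
  rw [Finset.sum_range, Finset.sum_congr rfl fun l _ => h2 l, hk]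
  abel

/-- An autoregression driven by white noise has the prescribed covariances. -/
theorem covariance_arSolution {V : Type*} [AddCommGroup V] [Module ℝ V]
    (B : LinearMap.BilinForm ℝ V) (hB : ∀ x y, B x y = B y x) {p : ℕ} {a : ℕ → ℝ} {b : ℕ → ℕ → ℝ}
    (hb0 : ∀ k, b k 0 = 1) (hbz : ∀ k j, min k p < j → b k j = 0)
    (hb : ∀ k, ∀ i ≤ min k p,
      ∑ j ∈ Finset.range (min k p + 1), b k j * a ((i : ℤ) - (j : ℤ)).natAbs =
        if i = 0 then predVar (min k p) a else 0)
    {s : ℕ → ℝ} {v : ℝ} (hs : ∀ k, s k ^ 2 * v = predVar (min k p) a) {w : ℕ → V}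
    (hw : ∀ k l, B (w k) (w l) = if k = l then v else 0) (k l : ℕ) (hl : l ≤ min k p) :
    B (arSolution b s w k) (arSolution b s w (k - l)) = a l := by
  set x := arSolution b s w with hx
  have hrec : ∀ k, x k = s k • w k -
      ∑ j ∈ Finset.range (min k p), b k (j + 1) • x (k - (j + 1)) := by
    intro k
    have h := arSolution_filter hb0 hbz s w k
    rw [Finset.sum_range_succ', hb0, one_smul, Nat.sub_zero] at h
    rw [← h]
    abel
  have hwx : ∀ j k, j < k → B (w k) (x j) = 0 := by
    intro j
    induction j using Nat.strong_induction_on with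
    | _ j ih =>
      intro k hjk
      rw [hrec j, map_sub, map_smul, hw, if_neg (by omega), map_sum]
      rw [Finset.sum_eq_zero, smul_zero, sub_zero]
      intro i hi
      have := Finset.mem_range.1 hi
      rw [map_smul, ih _ (by omega) _ (by omega), smul_zero]
  have hwx' : ∀ k, B (w k) (x k) = s k * v := by
    intro k
    rw [hrec k, map_sub, map_smul, hw, if_pos rfl, map_sum, Finset.sum_eq_zero, sub_zero,
      smul_eq_mul]
    intro i hi
    have := Finset.mem_range.1 hi
    rw [map_smul, hwx _ _ (by omega), smul_zero]
  have hleft : ∀ k y, B (x k) y = s k * B (w k) y -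
      ∑ j ∈ Finset.range (min k p), b k (j + 1) * B (x (k - (j + 1))) y := by
    intro k y
    nth_rewrite 1 [hrec k]
    rw [LinearMap.BilinForm.sub_left, LinearMap.BilinForm.smul_left, map_sum,
      LinearMap.sum_apply]
    congr 1
    exact Finset.sum_congr rfl fun j _ => by rw [LinearMap.BilinForm.smul_left]
  induction k using Nat.strong_induction_on generalizing l with
  | _ k ih =>
    have hpos : ∀ l, 1 ≤ l → l ≤ min k p → B (x k) (x (k - l)) = a l := by
      intro l hl1 hl
      have key := hb k l hl
      rw [Finset.sum_range_succ', hb0, one_mul, if_neg (by omega)] at key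
      rw [hleft, hwx _ _ (by omega), mul_zero, zero_sub]
      have hsum : ∀ j ∈ Finset.range (min k p), b k (j + 1) * B (x (k - (j + 1))) (x (k - l)) =
          b k (j + 1) * a ((l : ℤ) - ((j + 1 : ℕ) : ℤ)).natAbs := by
        intro j hj
        have hj' := Finset.mem_range.1 hj
        congr 1
        rcases le_total l (j + 1) with h | h
        · have e1 : k - (j + 1) = (k - l) - (j + 1 - l) := by omega
          have e2 : ((l : ℤ) - ((j + 1 : ℕ) : ℤ)).natAbs = j + 1 - l := by omega
          rw [hB, e1, e2]
          exact ih (k - l) (by omega) (j + 1 - l) (by omega)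
        · have e1 : k - l = (k - (j + 1)) - (l - (j + 1)) := by omega
          have e2 : ((l : ℤ) - ((j + 1 : ℕ) : ℤ)).natAbs = l - (j + 1) := by omega
          rw [e1, e2]
          exact ih (k - (j + 1)) (by omega) (l - (j + 1)) (by omega)
      rw [Finset.sum_congr rfl hsum]
      have e0 : ((l : ℤ) - ((0 : ℕ) : ℤ)).natAbs = l := by omega
      rw [e0] at key
      linarith
    rcases Nat.eq_zero_or_pos l with rfl | hl1
    · have key := hb k 0 (Nat.zero_le _)
      rw [Finset.sum_range_succ', hb0, one_mul, if_pos rfl, ← hs k] at key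
      rw [Nat.sub_zero, hleft, hwx']
      have hsum : ∀ j ∈ Finset.range (min k p), b k (j + 1) * B (x (k - (j + 1))) (x k) =
          b k (j + 1) * a (((0 : ℕ) : ℤ) - ((j + 1 : ℕ) : ℤ)).natAbs := by
        intro j hj
        have hj' := Finset.mem_range.1 hj
        have e2 : (((0 : ℕ) : ℤ) - ((j + 1 : ℕ) : ℤ)).natAbs = j + 1 := by omega
        rw [hB, e2, hpos (j + 1) (by omega) (by omega)]
      rw [Finset.sum_congr rfl hsum]
      have e0 : (((0 : ℕ) : ℤ) - ((0 : ℕ) : ℤ)).natAbs = 0 := by omega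
      rw [e0] at key
      linarith
    · exact hpos l hl1 hl

/-- Measurable square-integrable functions. -/
def measurableLTwo {Ω : Type*} {mΩ : MeasurableSpace Ω} (P : Measure Ω) :
    Submodule ℝ (Ω → ℝ) where
  carrier := {f | Measurable f ∧ MemLp f 2 P}
  add_mem' hf hg := ⟨hf.1.add hg.1, hf.2.add hg.2⟩
  zero_mem' := ⟨measurable_const, MemLp.zero⟩
  smul_mem' c _ hf := ⟨hf.1.const_smul c, hf.2.const_smul c⟩

/-- The bilinear form `E[f g]` on measurable square-integrable functions. -/
def expectationForm {Ω : Type*} {mΩ : MeasurableSpace Ω} (P : Measure Ω) :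
    LinearMap.BilinForm ℝ (measurableLTwo P) :=
  LinearMap.mk₂ ℝ (fun f g => ∫ ω, f.1 ω * g.1 ω ∂P)
    (fun f g h => by
      refine Eq.trans ?_ (integral_add (f.2.2.integrable_mul h.2.2) (g.2.2.integrable_mul h.2.2))
      simp [add_mul])
    (fun c f g => by rw [smul_eq_mul, ← integral_const_mul]; simp [mul_assoc])
    (fun f g h => by
      refine Eq.trans ?_ (integral_add (f.2.2.integrable_mul g.2.2) (f.2.2.integrable_mul h.2.2))
      simp [mul_add])
    (fun c f g => by rw [smul_eq_mul, ← integral_const_mul]; simp [mul_left_comm])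

/-- Existence of a process with the prescribed covariances, obtained by filtering white noise. -/
theorem satisfiesBurgConstraints_arSolution {p : ℕ} {a : ℕ → ℝ} {b : ℕ → ℕ → ℝ}
    (hb0 : ∀ k, b k 0 = 1) (hbz : ∀ k j, min k p < j → b k j = 0)
    (hb : ∀ k, ∀ i ≤ min k p,
      ∑ j ∈ Finset.range (min k p + 1), b k j * a ((i : ℤ) - (j : ℤ)).natAbs =
        if i = 0 then predVar (min k p) a else 0)
    {s : ℕ → ℝ} {v : ℝ} (hs : ∀ k, s k ^ 2 * v = predVar (min k p) a) {P : Measure (ℕ → ℝ)}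
    (hP : ∀ k, MemLp (fun ω : ℕ → ℝ => ω k) 2 P)
    (hw : ∀ k l, ∫ ω : ℕ → ℝ, ω k * ω l ∂P = if k = l then v else 0) :
    Measurable (fun (ω : ℕ → ℝ) k => arSolution b s ω k) ∧
      SatisfiesBurgConstraints (P.map fun ω k => arSolution b s ω k) p a := by
  set W : ℕ → measurableLTwo P := fun k => ⟨fun ω => ω k, measurable_pi_apply k, hP k⟩
  set X := arSolution b s W
  have hX : ∀ k, (X k).1 = fun ω => arSolution b s ω k := by
    intro k
    funext ω
    exact map_arSolution ((LinearMap.proj ω).comp (measurableLTwo P).subtype) b s W k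
  have hm : Measurable (fun (ω : ℕ → ℝ) k => arSolution b s ω k) :=
    measurable_pi_lambda _ fun k => by rw [← hX k]; exact (X k).2.1
  refine ⟨hm, fun i k hk => ?_⟩
  have hmeas : Measurable fun ω : ℕ → ℝ => ω i * ω (i + k) := by fun_prop
  have hcov := covariance_arSolution (expectationForm P)
    (fun f g => by simp [expectationForm, mul_comm]) hb0 hbz hb hs (w := W)
    (fun k l => hw k l) (i + k) k (by omega)
  rw [Nat.add_sub_cancel, show expectationForm P (X (i + k)) (X i) =
    ∫ ω, (X (i + k)).1 ω * (X i).1 ω ∂P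
    from rfl, hX, hX] at hcov
  have hi1 := (X i).2.2.integrable_mul (X (i + k)).2.2
  rw [hX, hX] at hi1
  constructor
  · rw [integrable_map_measure hmeas.aestronglyMeasurable hm.aemeasurable]
    exact hi1
  · rw [integral_map hm.aemeasurable hmeas.aestronglyMeasurable, ← hcov]
    exact integral_congr_ae (Eventually.of_forall fun ω => mul_comm _ _)

theorem le_smul_volume_of_map_toLin' {n : ℕ} {ν : Measure (Fin n → ℝ)}
    {M : Matrix (Fin n) (Fin n) ℝ} (hM : 0 < M.det) {c : ℝ} (hc : 0 ≤ c)
    (h : ν.map (Matrix.toLin' M) ≤ ENNReal.ofReal c • volume) :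
    ν ≤ ENNReal.ofReal (c * M.det) • volume := by
  have hm : ∀ N : Matrix (Fin n) (Fin n) ℝ, Measurable (Matrix.toLin' N) := fun N =>
    (Matrix.toLin' N).continuous_of_finiteDimensional.measurable
  have hid : (Matrix.toLin' M⁻¹ : (Fin n → ℝ) → Fin n → ℝ) ∘ (Matrix.toLin' M) = id := by
    funext x
    simp [Matrix.nonsing_inv_mul M hM.ne'.isUnit]
  have h1 : ν = (ν.map (Matrix.toLin' M)).map (Matrix.toLin' M⁻¹) := by
    rw [Measure.map_map (hm _) (hm _), hid, Measure.map_id]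
  rw [h1]
  refine (Measure.map_mono h (hm _)).trans_eq ?_
  have hdet : (M⁻¹).det = (M.det)⁻¹ := by
    rw [Matrix.det_nonsing_inv, Ring.inverse_eq_inv']
  rw [Measure.map_smul, Real.map_matrix_volume_pi_eq_smul_volume_pi
    (by rw [hdet]; exact inv_ne_zero hM.ne'), hdet, inv_inv, abs_of_pos hM, smul_smul,
    ENNReal.ofReal_mul hc]

theorem volume_toLin'_preimage {n : ℕ} {M : Matrix (Fin n) (Fin n) ℝ} (hM : 0 < M.det)
    (S : Set (Fin n → ℝ)) (hS : MeasurableSet S) :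
    volume (Matrix.toLin' M ⁻¹' S) = ENNReal.ofReal (M.det)⁻¹ * volume S := by
  rw [← Measure.map_apply (Matrix.toLin' M).continuous_of_finiteDimensional.measurable hS,
    Real.map_matrix_volume_pi_eq_smul_volume_pi hM.ne', abs_of_pos (inv_pos.2 hM),
    Measure.smul_apply, smul_eq_mul]

theorem lagMatrix_mulVec_arSolution {b : ℕ → ℕ → ℝ} {p : ℕ}
    (hb0 : ∀ k, b k 0 = 1) (hbz : ∀ k j, min k p < j → b k j = 0) {s : ℕ → ℝ} (hs : ∀ k, 0 < s k)
    (n : ℕ) (w : ℕ → ℝ) :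
    Matrix.toLin' (lagMatrix (fun k j => (s k)⁻¹ * b k j) n) (nvec n fun k => arSolution b s w k) =
      nvec n w := by
  funext k
  rw [Matrix.toLin'_apply]
  refine (lagMatrix_mulVec_apply (p := p) (fun k j h => by rw [hbz k j h, mul_zero]) _ k).trans ?_
  have := arSolution_filter hb0 hbz s w k
  simp only [smul_eq_mul] at this
  simp only [mul_assoc, ← Finset.mul_sum, this]
  rw [inv_mul_cancel_left₀ (hs k).ne']
  rfl

/-- Density bounds for the filtered process in terms of those of the noise. -/
theorem exists_densityFamily_arSolution {b : ℕ → ℕ → ℝ} {p : ℕ}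
    (hb0 : ∀ k, b k 0 = 1) (hbz : ∀ k j, min k p < j → b k j = 0) {s : ℕ → ℝ} (hs : ∀ k, 0 < s k)
    {P : Measure (ℕ → ℝ)} [IsProbabilityMeasure P]
    (hm : Measurable (fun (ω : ℕ → ℝ) k => arSolution b s ω k)) {lo hi : ℕ → ℝ}
    (hlo : ∀ n, P.map (nvec n) ≤ ENNReal.ofReal (Real.exp (-lo n)) • volume)
    (hhi : ∀ n, ∃ S, MeasurableSet S ∧ P.map (nvec n) S = 1 ∧
      volume S ≤ ENNReal.ofReal (Real.exp (hi n))) {α : ℝ} (hα : 1 < α) :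
    ∃ F : (n : ℕ) → (Fin n → ℝ) → ℝ,
      HasDensityFamilyNat (P.map fun ω k => arSolution b s ω k) F ∧
      ∀ n, ((lo n + ∑ k ∈ Finset.range n, Real.log (s k) : ℝ) : EReal) ≤ renyiEntropy (F n) α ∧
        renyiEntropy (F n) α ≤ ((hi n + ∑ k ∈ Finset.range n, Real.log (s k) : ℝ) : EReal) := by
  have hn : ∀ n, Measurable (nvec n) := fun n => by unfold nvec; fun_prop
  have key : ∀ n, ∃ f, (IsDensity f ∧ (P.map fun ω k => arSolution b s ω k).map (nvec n) =
      volume.withDensity (fun x => ENNReal.ofReal (f x))) ∧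
      ((lo n + ∑ k ∈ Finset.range n, Real.log (s k) : ℝ) : EReal) ≤ renyiEntropy f α ∧
        renyiEntropy f α ≤ ((hi n + ∑ k ∈ Finset.range n, Real.log (s k) : ℝ) : EReal) := by
    intro n
    set M := lagMatrix (fun k j => (s k)⁻¹ * b k j) n with hM
    have hdet : M.det = Real.exp (-∑ k ∈ Finset.range n, Real.log (s k)) := by
      rw [hM, det_lagMatrix, ← Finset.sum_neg_distrib, Real.exp_sum, ← Fin.prod_univ_eq_prod_range
        (fun k => Real.exp (-Real.log (s k)))]
      refine Finset.prod_congr rfl fun k _ => ?_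
      rw [hb0, mul_one, Real.exp_neg, Real.exp_log (hs k)]
    have hMpos : 0 < M.det := by rw [hdet]; exact Real.exp_pos _
    set ν := (P.map fun ω k => arSolution b s ω k).map (nvec n) with hν
    have hTm : Measurable (Matrix.toLin' M) :=
      (Matrix.toLin' M).continuous_of_finiteDimensional.measurable
    have hmap : ν.map (Matrix.toLin' M) = P.map (nvec n) := by
      rw [hν, Measure.map_map (hn n) hm, Measure.map_map hTm ((hn n).comp hm)]
      congr 1
      funext ω
      exact lagMatrix_mulVec_arSolution hb0 hbz hs n ω
    have : IsProbabilityMeasure (P.map fun ω k => arSolution b s ω k) :=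
      Measure.isProbabilityMeasure_map hm.aemeasurable
    have : IsProbabilityMeasure ν := Measure.isProbabilityMeasure_map (hn n).aemeasurable
    have hdom : ν ≤ ENNReal.ofReal (Real.exp (-lo n) * M.det) • volume :=
      le_smul_volume_of_map_toLin' hMpos (Real.exp_pos _).le (hmap ▸ hlo n)
    obtain ⟨f, hf, hfν, hb⟩ :=
      exists_density_renyiEntropy_bounds (mul_pos (Real.exp_pos _) hMpos) hdom
    obtain ⟨h1, h2⟩ := hb α hα
    obtain ⟨S, hS, hS1, hSv⟩ := hhi n
    refine ⟨f, ⟨hf, hfν⟩, ?_, ?_⟩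
    · rwa [hdet, ← Real.exp_add, Real.log_exp, neg_add, neg_neg, neg_neg] at h1
    · have h3 := h2 (Matrix.toLin' M ⁻¹' S) (hTm hS)
        (by rw [← Measure.map_apply hTm hS, hmap, hS1])
        (Real.exp (hi n + ∑ k ∈ Finset.range n, Real.log (s k))) (Real.exp_pos _) (by
          rw [volume_toLin'_preimage hMpos S hS, hdet, ← Real.exp_neg, neg_neg, add_comm (hi n),
            Real.exp_add, ENNReal.ofReal_mul (Real.exp_pos _).le]
          gcongr)
      rwa [Real.log_exp] at h3
  choose F hF using key
  exact ⟨F, fun n => (hF n).1, fun n => (hF n).2⟩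

/-- The closed Euclidean ball of radius `√m` in `ℝᵐ`. -/
def powerBall (m : ℕ) : Set (Fin m → ℝ) := {x | ∑ i, x i ^ 2 ≤ m}

theorem measurableSet_powerBall (m : ℕ) : MeasurableSet (powerBall m) :=
  measurableSet_le (by fun_prop) measurable_const

theorem powerBall_subset (m : ℕ) : powerBall m ⊆ Set.univ.pi fun _ => Set.Icc (-√m) √m := by
  intro x hx i _
  have h : x i ^ 2 ≤ m :=
    (Finset.single_le_sum (f := fun i => x i ^ 2) (fun j _ => sq_nonneg _)
      (Finset.mem_univ i)).trans hx
  exact abs_le.1 (Real.abs_le_sqrt h)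

theorem volume_powerBall {k : ℕ} (hk : 0 < k) :
    volume (powerBall (2 * k)) =
      ENNReal.ofReal ((2 * k) ^ k * Real.pi ^ k / k.factorial) := by
  have : Nonempty (Fin (2 * k)) := ⟨⟨0, by omega⟩⟩
  have h := volume_sum_rpow_le (Fin (2 * k)) (p := 2) (by norm_num) √(2 * k : ℝ)
  have hset : {x : Fin (2 * k) → ℝ | (∑ i, |x i| ^ (2 : ℝ)) ^ (1 / (2 : ℝ)) ≤ √(2 * k : ℝ)} =
      powerBall (2 * k) := by
    ext x
    rw [Set.mem_ofPred_eq, ← Real.sqrt_eq_rpow, Real.sqrt_le_sqrt_iff (by positivity)]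
    simp [powerBall]
  rw [hset] at h
  rw [h, Fintype.card_fin, ← ENNReal.ofReal_pow (Real.sqrt_nonneg _),
    ← ENNReal.ofReal_mul (by positivity), Real.Gamma_add_one (by norm_num), Real.Gamma_one_half_eq]
  congr 1
  rw [pow_mul, Real.sq_sqrt (by positivity), show (2 : ℝ) * (1 / 2 * √Real.pi) = √Real.pi by ring,
    pow_mul, Real.sq_sqrt Real.pi_pos.le,
    show ((2 * k : ℕ) : ℝ) / 2 + 1 = (k : ℝ) + 1 by push_cast; ring, Real.Gamma_nat_eq_factorial]
  ring

theorem tendsto_log_volume_powerBall :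
    Tendsto (fun k : ℕ => (2 * k : ℝ)⁻¹ *
      Real.log ((2 * k) ^ k * Real.pi ^ k / k.factorial)) atTop
      (nhds (1 / 2 * Real.log (2 * Real.pi * Real.exp 1))) := by
  have h1 : Tendsto (fun k : ℕ => (2 * k : ℝ)⁻¹) atTop (nhds 0) :=
    tendsto_inv_atTop_zero.comp (tendsto_natCast_atTop_atTop.const_mul_atTop two_pos)
  have h2 : Tendsto (fun k : ℕ => Real.log (Stirling.stirlingSeq k)) atTop
      (nhds (Real.log √Real.pi)) :=
    Stirling.tendsto_stirlingSeq_sqrt_pi.log (Real.sqrt_pos.2 Real.pi_pos).ne'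
  have h3 : Tendsto (fun k : ℕ => (2 * k : ℝ)⁻¹ * Real.log (2 * k)) atTop (nhds 0) := by
    have : Tendsto (fun x : ℝ => x⁻¹ * Real.log x) atTop (nhds 0) := by
      refine (Real.tendsto_pow_log_div_mul_add_atTop 1 0 1 one_ne_zero).congr fun x => ?_
      rw [pow_one, one_mul, add_zero, div_eq_inv_mul]
    exact this.comp (tendsto_natCast_atTop_atTop.const_mul_atTop two_pos)
  have h4 := (tendsto_const_nhds (x := 1 / 2 * Real.log (2 * Real.pi * Real.exp 1))).sub
    ((h1.mul h2).add (h3.const_mul (1 / 2)))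
  simp only [zero_mul, mul_zero, add_zero, sub_zero] at h4
  refine h4.congr' ?_
  filter_upwards [eventually_gt_atTop 0] with k hk
  have hk' : (0 : ℝ) < k := Nat.cast_pos.2 hk
  have hf : (0 : ℝ) < k.factorial := Nat.cast_pos.2 k.factorial_pos
  have h5 := Stirling.log_stirlingSeq_formula k
  have h6 : Real.log ((2 * k) ^ k * Real.pi ^ k / k.factorial) =
      k * (Real.log 2 + Real.log k) + k * Real.log Real.pi - Real.log k.factorial := by
    rw [Real.log_div (by positivity) hf.ne', Real.log_mul (by positivity) (by positivity),
      Real.log_pow, Real.log_pow, Real.log_mul two_ne_zero hk'.ne']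
  have h7 : Real.log (2 * Real.pi * Real.exp 1) = Real.log 2 + Real.log Real.pi + 1 := by
    rw [Real.log_mul (by positivity) (Real.exp_pos _).ne', Real.log_mul two_ne_zero Real.pi_pos.ne',
      Real.log_exp]
  rw [Real.log_div hk'.ne' (Real.exp_pos _).ne', Real.log_exp, Real.log_mul two_ne_zero hk'.ne']
    at h5
  rw [h5, h6, h7, Real.log_mul two_ne_zero hk'.ne']
  field_simp
  ring

theorem pi_smul_restrict {ι X : Type*} [Fintype ι] {mX : MeasurableSpace X} (μ : Measure X)
    [SigmaFinite μ] (c : ℝ≥0∞) (s : Set X) [SigmaFinite (c • μ.restrict s)] :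
    (Measure.pi fun _ : ι => c • μ.restrict s) =
      c ^ Fintype.card ι • (Measure.pi fun _ : ι => μ).restrict (Set.univ.pi fun _ => s) := by
  refine Measure.pi_eq fun t ht => ?_
  rw [Measure.restrict_pi_pi, Measure.smul_apply, Measure.pi_pi]
  simp [Finset.prod_mul_distrib]

/-- Concatenation of `Q` blocks of length `m`, truncated to `n ≤ Q * m` coordinates. -/
def unblock {m Q n : ℕ} (hm : 0 < m) (h : n ≤ Q * m) (η : Fin Q → Fin m → ℝ) : Fin n → ℝ :=
  fun i => η ⟨i / m, (Nat.div_lt_iff_lt_mul hm).2 (i.2.trans_le h)⟩ ⟨i % m, Nat.mod_lt _ hm⟩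

/-- The first `q` blocks of length `m` of a vector with `n ≥ q * m` coordinates. -/
def block {m q n : ℕ} (h : q * m ≤ n) (x : Fin n → ℝ) : Fin q → Fin m → ℝ :=
  fun j i => x ⟨j * m + i, by
    have h1 := Nat.mul_le_mul_right m j.2
    rw [Nat.succ_mul] at h1
    omega⟩

theorem measurable_unblock {m Q n : ℕ} (hm : 0 < m) (h : n ≤ Q * m) :
    Measurable (unblock hm h) := by
  unfold unblock
  fun_prop

theorem measurable_block {m q n : ℕ} (h : q * m ≤ n) : Measurable (block h) := by
  unfold block
  fun_prop

theorem map_unblock (ρ : Measure ℝ) [IsProbabilityMeasure ρ] {m Q n : ℕ} (hm : 0 < m)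
    (h : n ≤ Q * m) :
    (Measure.pi fun _ : Fin Q => Measure.pi fun _ : Fin m => ρ).map (unblock hm h) =
      Measure.pi fun _ : Fin n => ρ := by
  set f : Fin n → Fin Q × Fin m := fun i =>
    (⟨i / m, (Nat.div_lt_iff_lt_mul hm).2 (i.2.trans_le h)⟩, ⟨i % m, Nat.mod_lt _ hm⟩)
  have hf : Function.Injective f := by
    intro i j hij
    simp only [f, Prod.mk.injEq, Fin.mk.injEq] at hij
    ext
    rw [← Nat.div_add_mod (i : ℕ) m, ← Nat.div_add_mod (j : ℕ) m, hij.1, hij.2]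
  have h1 := Measure.infinitePi_map_curry_symm (fun (_ : Fin Q) (_ : Fin m) => ρ)
  have h2 := Measure.map_infinitePi_infinitePi_of_inj (P := fun _ : Fin Q × Fin m => ρ) hf
  rw [← h1, Measure.map_map (by fun_prop) (by fun_prop)] at h2
  simp only [Measure.infinitePi_eq_pi] at h2
  exact h2

theorem map_block (ρ : Measure ℝ) [IsProbabilityMeasure ρ] {m q n : ℕ} (h : q * m ≤ n) :
    (Measure.pi fun _ : Fin n => ρ).map (block h) =
      Measure.pi fun _ : Fin q => Measure.pi fun _ : Fin m => ρ := by
  set f : Fin q × Fin m → Fin n := fun x => ⟨x.1 * m + x.2, by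
    have h1 := Nat.mul_le_mul_right m x.1.2
    rw [Nat.succ_mul] at h1
    omega⟩
  have hf : Function.Injective f := by
    rintro ⟨i, i'⟩ ⟨j, j'⟩ hij
    simp only [f, Fin.mk.injEq] at hij
    have hm : 0 < m := i'.pos
    have e1 : (i : ℕ) = j := by
      have := congrArg (· / m) hij
      simpa [Nat.add_div_of_dvd_right, Nat.mul_div_cancel _ hm, Nat.div_eq_of_lt i'.2,
        Nat.div_eq_of_lt j'.2, Nat.add_comm, Nat.add_mul_div_right _ _ hm] using this
    rw [e1] at hij
    have e2 : (i' : ℕ) = j' := by omega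
    rw [Fin.ext e1, Fin.ext e2]
  have h1 := Measure.infinitePi_map_curry (fun (_ : Fin q) (_ : Fin m) => ρ)
  have h2 := Measure.map_infinitePi_infinitePi_of_inj (P := fun _ : Fin n => ρ) hf
  rw [← h2, Measure.map_map (by fun_prop) (by fun_prop)] at h1
  simp only [Measure.infinitePi_eq_pi] at h1
  exact h1

/-- The uniform distribution on `[-√m, √m]`. -/
def uniformCoord (m : ℕ) : Measure ℝ :=
  (ENNReal.ofReal (2 * √m))⁻¹ • volume.restrict (Set.Icc (-√m) √m)

instance isProbabilityMeasure_uniformCoord (m : ℕ) [NeZero m] :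
    IsProbabilityMeasure (uniformCoord m) := by
  have h : 0 < √(m : ℝ) := Real.sqrt_pos.2 (Nat.cast_pos.2 (NeZero.pos m))
  constructor
  rw [uniformCoord, Measure.smul_apply, Measure.restrict_apply_univ, Real.volume_Icc, smul_eq_mul,
    sub_neg_eq_add, ← two_mul]
  exact ENNReal.inv_mul_cancel (by simpa using h) ENNReal.ofReal_ne_top

/-- The uniform distribution on the cube `[-√m, √m]ⁿ`. -/
def uniformCube (m n : ℕ) : Measure (Fin n → ℝ) := Measure.pi fun _ => uniformCoord m

instance isProbabilityMeasure_uniformCube (m n : ℕ) [NeZero m] :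
    IsProbabilityMeasure (uniformCube m n) := by
  unfold uniformCube
  infer_instance

theorem uniformCube_eq (m n : ℕ) [NeZero m] : uniformCube m n =
    (ENNReal.ofReal (2 * √m))⁻¹ ^ n •
      volume.restrict (Set.univ.pi fun _ => Set.Icc (-√m) √m) := by
  have := isProbabilityMeasure_uniformCoord m
  rw [uniformCoord] at this
  have h := pi_smul_restrict (ι := Fin n) volume (ENNReal.ofReal (2 * √m))⁻¹ (Set.Icc (-√m) √m)
  rw [Fintype.card_fin] at h
  exact h

theorem uniformCube_powerBall (m : ℕ) [NeZero m] : uniformCube m m (powerBall m) =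
    (ENNReal.ofReal (2 * √m))⁻¹ ^ m * volume (powerBall m) := by
  rw [uniformCube_eq, Measure.smul_apply, Measure.restrict_apply (measurableSet_powerBall m),
    Set.inter_eq_left.2 (powerBall_subset m), smul_eq_mul]

theorem uniformCube_powerBall_ne_zero (m : ℕ) [NeZero m] : uniformCube m m (powerBall m) ≠ 0 := by
  have hm : (1 : ℝ) ≤ m := Nat.one_le_cast.2 (NeZero.pos m)
  rw [uniformCube_powerBall]
  refine mul_ne_zero (pow_ne_zero _ (ENNReal.inv_ne_zero.2 ENNReal.ofReal_ne_top)) ?_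
  have hsub : (Set.univ.pi fun _ => Set.Icc (-1) 1) ⊆ powerBall m := by
    intro x hx
    calc ∑ i, x i ^ 2 ≤ ∑ _i : Fin m, (1 : ℝ) := Finset.sum_le_sum fun i _ =>
          (sq_le_one_iff_abs_le_one _).2 (abs_le.2 (hx i trivial))
      _ = m := by simp
  refine ne_of_gt (lt_of_lt_of_le ?_ (measure_mono hsub))
  rw [volume_pi_pi]
  simp only [Real.volume_Icc, Finset.prod_const]
  exact ENNReal.pow_pos (ENNReal.ofReal_pos.2 (by norm_num)) _

/-- The uniform distribution on the Euclidean ball of radius `√m` in `ℝᵐ`. -/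
def uniformBall (m : ℕ) : Measure (Fin m → ℝ) :=
  (uniformCube m m (powerBall m))⁻¹ • (uniformCube m m).restrict (powerBall m)

instance isProbabilityMeasure_uniformBall (m : ℕ) [NeZero m] :
    IsProbabilityMeasure (uniformBall m) := by
  constructor
  rw [uniformBall, Measure.smul_apply, Measure.restrict_apply_univ, smul_eq_mul]
  exact ENNReal.inv_mul_cancel (uniformCube_powerBall_ne_zero m) (measure_ne_top _ _)

theorem ae_mem_powerBall (m : ℕ) : ∀ᵐ x ∂uniformBall m, x ∈ powerBall m :=
  Measure.ae_smul_measure (ae_restrict_mem (measurableSet_powerBall m)) _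

/-- Independent blocks of length `m`, each uniform on the ball, as one sequence. -/
def blockNoise (m : ℕ) [NeZero m] : Measure (ℕ → ℝ) :=
  (Measure.infinitePi fun _ : ℕ => uniformBall m).map fun η i =>
    η (i / m) ⟨i % m, Nat.mod_lt _ (NeZero.pos m)⟩

instance isProbabilityMeasure_blockNoise (m : ℕ) [NeZero m] :
    IsProbabilityMeasure (blockNoise m) :=
  Measure.isProbabilityMeasure_map (Measurable.aemeasurable (by fun_prop))

theorem map_nvec_blockNoise (m : ℕ) [NeZero m] {Q n : ℕ} (h : n ≤ Q * m) :
    (blockNoise m).map (nvec n) =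
      (Measure.pi fun _ : Fin Q => uniformBall m).map (unblock (NeZero.pos m) h) := by
  have h1 := Measure.map_infinitePi_infinitePi_of_inj (P := fun _ : ℕ => uniformBall m)
    (Fin.val_injective (n := Q))
  rw [Measure.infinitePi_eq_pi (μ := fun _ : Fin Q => uniformBall m)] at h1
  rw [← h1, Measure.map_map (measurable_unblock _ h) (by fun_prop), blockNoise,
    Measure.map_map (by unfold nvec; fun_prop) (by fun_prop)]
  rfl

theorem map_nvec_blockNoise_le (m : ℕ) [NeZero m] {Q n : ℕ} (h : n ≤ Q * m) :
    (blockNoise m).map (nvec n) ≤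
      ((uniformCube m m (powerBall m))⁻¹ ^ Q * (ENNReal.ofReal (2 * √m))⁻¹ ^ n) • volume := by
  have hprob := isProbabilityMeasure_uniformBall m
  rw [uniformBall] at hprob
  have h1 : (Measure.pi fun _ : Fin Q => uniformBall m) ≤
      (uniformCube m m (powerBall m))⁻¹ ^ Q • Measure.pi fun _ : Fin Q => uniformCube m m := by
    have h2 := pi_smul_restrict (ι := Fin Q) (uniformCube m m) (uniformCube m m (powerBall m))⁻¹
      (powerBall m)
    rw [Fintype.card_fin] at h2
    refine h2.trans_le ?_
    gcongr
    exact Measure.restrict_le_self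
  rw [map_nvec_blockNoise m h]
  refine (Measure.map_mono h1 (measurable_unblock _ h)).trans ?_
  rw [Measure.map_smul, mul_smul]
  gcongr
  refine (map_unblock (uniformCoord m) (NeZero.pos m) h).trans_le ?_
  refine (uniformCube_eq m n).trans_le ?_
  gcongr
  exact Measure.restrict_le_self

theorem exists_support_blockNoise (m : ℕ) [NeZero m] {q n : ℕ} (h : q * m ≤ n) :
    ∃ S, MeasurableSet S ∧ (blockNoise m).map (nvec n) S = 1 ∧
      volume S ≤ ENNReal.ofReal (2 * √m) ^ n * uniformCube m m (powerBall m) ^ q := by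
  have hm : 0 < √(m : ℝ) := Real.sqrt_pos.2 (Nat.cast_pos.2 (NeZero.pos m))
  set T : Set (Fin n → ℝ) := block h ⁻¹' Set.univ.pi fun _ => powerBall m
  set C : Set (Fin n → ℝ) := Set.univ.pi fun _ => Set.Icc (-√m) √m
  have hT : MeasurableSet T :=
    measurable_block h (MeasurableSet.univ_pi fun _ => measurableSet_powerBall m)
  have hC : MeasurableSet C := MeasurableSet.univ_pi fun _ => measurableSet_Icc
  refine ⟨T ∩ C, hT.inter hC, ?_, ?_⟩
  · have hn : Measurable (nvec n) := by unfold nvec; fun_prop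
    have hae : ∀ᵐ η ∂(Measure.infinitePi fun _ : ℕ => uniformBall m), ∀ j, η j ∈ powerBall m :=
      ae_all_iff.2 fun j =>
        (measurePreserving_eval_infinitePi (fun _ : ℕ => uniformBall m) j).quasiMeasurePreserving.ae
          (ae_mem_powerBall m)
    have := Measure.isProbabilityMeasure_map (μ := blockNoise m) hn.aemeasurable
    rw [← mem_ae_iff_prob_eq_one (hT.inter hC)]
    change ∀ᵐ x ∂(blockNoise m).map (nvec n), x ∈ T ∩ C
    refine (ae_map_iff hn.aemeasurable (p := fun x => x ∈ T ∩ C) (hT.inter hC)).2 ?_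
    refine (ae_map_iff (Measurable.aemeasurable (by fun_prop))
      (p := fun ω => nvec n ω ∈ T ∩ C) (hn (hT.inter hC))).2 ?_
    filter_upwards [hae] with η hη
    refine ⟨fun j _ => ?_, fun i _ => powerBall_subset m (hη _) _ trivial⟩
    convert hη j using 1
    funext i
    have e1 : ((j : ℕ) * m + i) / m = j := by
      rw [Nat.add_comm, Nat.add_mul_div_right _ _ (NeZero.pos m), Nat.div_eq_of_lt i.2, zero_add]
    have e2 : ((j : ℕ) * m + i) % m = i := by
      rw [Nat.add_comm, Nat.add_mul_mod_self_right, Nat.mod_eq_of_lt i.2]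
    simp only [block, nvec, e1, e2]
  · have h1 : uniformCube m n T = uniformCube m m (powerBall m) ^ q := by
      rw [← Measure.map_apply (measurable_block h)
        (MeasurableSet.univ_pi fun _ => measurableSet_powerBall m)]
      refine (congrArg (fun μ : Measure (Fin q → Fin m → ℝ) =>
        μ (Set.univ.pi fun _ => powerBall m)) (map_block (uniformCoord m) h)).trans ?_
      rw [Measure.pi_pi]
      simp [uniformCube]
    rw [uniformCube_eq, Measure.smul_apply, Measure.restrict_apply hT, smul_eq_mul] at h1
    have h0 : ENNReal.ofReal (2 * √m) ≠ 0 := by simpa using hm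
    rw [← h1, ← mul_assoc, ← mul_pow, ENNReal.mul_inv_cancel h0 ENNReal.ofReal_ne_top, one_pow,
      one_mul]

theorem measurePreserving_uniformBall {m : ℕ} {T : (Fin m → ℝ) → Fin m → ℝ}
    (hT : MeasurePreserving T (uniformCube m m) (uniformCube m m))
    (hball : T ⁻¹' powerBall m = powerBall m) :
    MeasurePreserving T (uniformBall m) (uniformBall m) := by
  have h := hT.restrict_preimage (measurableSet_powerBall m)
  rw [hball] at h
  exact h.smul_measure _

theorem measurePreserving_neg_uniformCoord (m : ℕ) :
    MeasurePreserving (fun x : ℝ => -x) (uniformCoord m) (uniformCoord m) := by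
  have h := (Measure.measurePreserving_neg (volume : Measure ℝ)).restrict_preimage
    (measurableSet_Icc (a := -√(m : ℝ)) (b := √m))
  have hpre : Neg.neg ⁻¹' Set.Icc (-√(m : ℝ)) √m = Set.Icc (-√m) √m := by
    ext x
    simp only [Set.mem_preimage, Set.mem_Icc]
    constructor <;> rintro ⟨h1, h2⟩ <;> constructor <;> linarith
  rw [hpre] at h
  exact h.smul_measure _

theorem measurePreserving_flip_uniformBall (m : ℕ) [NeZero m] (i : Fin m) :
    MeasurePreserving (fun x j => if j = i then -x j else x j)
      (uniformBall m) (uniformBall m) := by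
  refine measurePreserving_uniformBall ?_ ?_
  · exact measurePreserving_pi (fun _ => uniformCoord m) (fun _ => uniformCoord m)
      (f := fun j y => if j = i then -y else y) fun j => by
        by_cases h : j = i
        · simpa [h] using measurePreserving_neg_uniformCoord m
        · simpa only [if_neg h] using! MeasurePreserving.id (uniformCoord m)
  · ext x
    simp only [powerBall, Set.mem_preimage, Set.mem_ofPred_eq, ite_pow, neg_sq, ite_self]

theorem measurePreserving_swap_uniformBall (m : ℕ) [NeZero m] (i j : Fin m) :
    MeasurePreserving (fun x k => x (Equiv.swap i j k)) (uniformBall m) (uniformBall m) := by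
  refine measurePreserving_uniformBall ⟨by fun_prop, ?_⟩ ?_
  · have h := Measure.map_infinitePi_infinitePi_of_inj (P := fun _ : Fin m => uniformCoord m)
      (Equiv.swap i j).injective
    rwa [Measure.infinitePi_eq_pi] at h
  · ext x
    simp only [powerBall, Set.mem_preimage, Set.mem_ofPred_eq]
    rw [Equiv.sum_comp (Equiv.swap i j) fun k => x k ^ 2]

theorem integral_comp_of_measurePreserving {X : Type*} {mX : MeasurableSpace X} {μ : Measure X}
    {T : X → X} (hT : MeasurePreserving T μ μ) {g : X → ℝ} (hg : Measurable g) :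
    ∫ x, g (T x) ∂μ = ∫ x, g x ∂μ := by
  conv_rhs => rw [← hT.map_eq]
  exact (integral_map hT.measurable.aemeasurable hg.aestronglyMeasurable).symm

theorem ae_abs_le_uniformBall (m : ℕ) (i : Fin m) : ∀ᵐ x ∂uniformBall m, |x i| ≤ √m := by
  filter_upwards [ae_mem_powerBall m] with x hx
  exact abs_le.2 (powerBall_subset m hx i trivial)

theorem integrable_mul_uniformBall (m : ℕ) [NeZero m] (i j : Fin m) :
    Integrable (fun x => x i * x j) (uniformBall m) := by
  refine Integrable.of_bound (by fun_prop) (√m * √m) ?_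
  filter_upwards [ae_abs_le_uniformBall m i, ae_abs_le_uniformBall m j] with x hi hj
  rw [norm_mul]
  exact mul_le_mul hi hj (abs_nonneg _) (Real.sqrt_nonneg _)

theorem integral_coord_uniformBall (m : ℕ) [NeZero m] (i : Fin m) :
    ∫ x, x i ∂uniformBall m = 0 := by
  have h := integral_comp_of_measurePreserving (measurePreserving_flip_uniformBall m i)
    (g := fun x => x i) (by fun_prop)
  simp only [if_true, integral_neg] at h
  linarith

theorem integral_mul_uniformBall_of_ne (m : ℕ) [NeZero m] {i j : Fin m} (hij : i ≠ j) :
    ∫ x, x i * x j ∂uniformBall m = 0 := by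
  have h := integral_comp_of_measurePreserving (measurePreserving_flip_uniformBall m i)
    (g := fun x => x i * x j) (by fun_prop)
  simp only [if_true, if_neg hij.symm, neg_mul, integral_neg] at h
  linarith

/-- The common variance of the coordinates under the uniform distribution on the ball. -/
def ballVar (m : ℕ) [NeZero m] : ℝ := ∫ x, x 0 * x 0 ∂uniformBall m

theorem integral_sq_uniformBall (m : ℕ) [NeZero m] (i : Fin m) :
    ∫ x, x i * x i ∂uniformBall m = ballVar m := by
  have h := integral_comp_of_measurePreserving (measurePreserving_swap_uniformBall m 0 i)
    (g := fun x => x 0 * x 0) (by fun_prop)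
  simpa [ballVar] using h

theorem ballVar_le_one (m : ℕ) [NeZero m] : ballVar m ≤ 1 := by
  have hm : (0 : ℝ) < m := Nat.cast_pos.2 (NeZero.pos m)
  have h1 : ∫ x, ∑ i, x i * x i ∂uniformBall m = m * ballVar m := by
    rw [integral_finsetSum _ fun i _ => integrable_mul_uniformBall m i i]
    simp [integral_sq_uniformBall]
  have h2 : ∫ x, ∑ i, x i * x i ∂uniformBall m ≤ ∫ _, (m : ℝ) ∂uniformBall m := by
    refine integral_mono_ae (integrable_finsetSum _ fun i _ => integrable_mul_uniformBall m i i)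
      (integrable_const _) ?_
    filter_upwards [ae_mem_powerBall m] with x hx
    simpa only [powerBall, Set.mem_ofPred_eq, sq] using hx
  rw [h1, integral_const, probReal_univ, one_smul] at h2
  exact (mul_le_iff_le_one_right hm).1 h2

theorem ballVar_pos (m : ℕ) [NeZero m] : 0 < ballVar m := by
  refine lt_of_le_of_ne (integral_nonneg fun x => mul_self_nonneg _) fun h => ?_
  have h1 := (integral_eq_zero_iff_of_nonneg (fun x : Fin m → ℝ => mul_self_nonneg (x 0))
    (integrable_mul_uniformBall m 0 0)).1 h.symm
  have h2 : ∀ᵐ x ∂(volume : Measure (Fin m → ℝ)), x 0 ≠ 0 := Measure.ae_eval_ne _ _ _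
  have h3 : ∀ᵐ x ∂uniformBall m, x 0 ≠ 0 := by
    rw [uniformBall, uniformCube_eq]
    exact Measure.ae_smul_measure (ae_restrict_of_ae
      (Measure.ae_smul_measure (ae_restrict_of_ae h2) _)) _
  obtain ⟨x, hx1, hx2⟩ := (h1.and h3).exists
  exact hx2 (mul_self_eq_zero.1 hx1)

theorem memLp_blockNoise (m : ℕ) [NeZero m] (k : ℕ) :
    MemLp (fun ω : ℕ → ℝ => ω k) 2 (blockNoise m) := by
  refine MemLp.of_bound (measurable_pi_apply k).aestronglyMeasurable √m ?_
  refine (ae_map_iff (Measurable.aemeasurable (by fun_prop)) (p := fun ω : ℕ → ℝ => ‖ω k‖ ≤ √m)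
    (measurableSet_le (by fun_prop) measurable_const)).2 ?_
  exact (measurePreserving_eval_infinitePi (fun _ : ℕ => uniformBall m)
    (k / m)).quasiMeasurePreserving.ae (ae_abs_le_uniformBall m _)

theorem integral_mul_blockNoise (m : ℕ) [NeZero m] (k l : ℕ) :
    ∫ ω : ℕ → ℝ, ω k * ω l ∂blockNoise m = if k = l then ballVar m else 0 := by
  rw [blockNoise, integral_map (Measurable.aemeasurable (by fun_prop))
    (Measurable.aestronglyMeasurable (by fun_prop))]
  set i : Fin m := ⟨k % m, Nat.mod_lt _ (NeZero.pos m)⟩ with hi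
  set j : Fin m := ⟨l % m, Nat.mod_lt _ (NeZero.pos m)⟩ with hj
  by_cases hkl : k / m = l / m
  · have h1 : ∫ η, η (k / m) i * η (l / m) j ∂(Measure.infinitePi fun _ : ℕ => uniformBall m) =
        ∫ x, x i * x j ∂uniformBall m := by
      rw [← hkl]
      conv_rhs => rw [← Measure.infinitePi_map_eval (fun _ : ℕ => uniformBall m) (k / m)]
      rw [integral_map (Measurable.aemeasurable (by fun_prop))
        (Measurable.aestronglyMeasurable (by fun_prop))]
    rw [h1]
    by_cases h : k = l
    · have hij : j = i := by rw [hi, hj, Fin.mk.injEq, h]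
      rw [if_pos h, hij, integral_sq_uniformBall]
    · have hij : i ≠ j := fun hij => h <| by
        rw [hi, hj, Fin.mk.injEq] at hij
        rw [← Nat.div_add_mod k m, ← Nat.div_add_mod l m, hkl, hij]
      rw [if_neg h, integral_mul_uniformBall_of_ne m hij]
  · have h1 : ∫ η, η (k / m) i * η (l / m) j ∂(Measure.infinitePi fun _ : ℕ => uniformBall m) =
        ∫ z : (Fin m → ℝ) × (Fin m → ℝ), z.1 i * z.2 j ∂(uniformBall m).prod (uniformBall m) := by
      rw [← Measure.infinitePi_map_eval_prod (P := fun _ : ℕ => uniformBall m) hkl,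
        integral_map (Measurable.aemeasurable (by fun_prop))
          (Measurable.aestronglyMeasurable (by fun_prop))]
    rw [h1, integral_prod_mul (fun x : Fin m → ℝ => x i) (fun x : Fin m → ℝ => x j),
      integral_coord_uniformBall, zero_mul, if_neg fun h => hkl (by rw [h])]

theorem tendsto_inv_mul_natCast_div {m : ℕ} (hm : 0 < m) :
    Tendsto (fun n : ℕ => (n : ℝ)⁻¹ * (n / m : ℕ)) atTop (nhds (m : ℝ)⁻¹) := by
  have hm' : (0 : ℝ) < m := Nat.cast_pos.2 hm
  have h1 : Tendsto (fun n : ℕ => (m : ℝ)⁻¹ - (n : ℝ)⁻¹) atTop (nhds (m : ℝ)⁻¹) := by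
    simpa using tendsto_const_nhds.sub (tendsto_inv_atTop_nhds_zero_nat (𝕜 := ℝ))
  refine tendsto_of_tendsto_of_tendsto_of_le_of_le' h1 tendsto_const_nhds ?_ ?_
  · filter_upwards [eventually_gt_atTop 0] with n hn
    have hn' : (0 : ℝ) < n := Nat.cast_pos.2 hn
    have h2 : (n : ℝ) < ((n / m : ℕ) + 1) * m := by
      exact_mod_cast (Nat.mul_comm m _ ▸ Nat.lt_mul_div_succ n hm)
    field_simp
    linarith
  · filter_upwards [eventually_gt_atTop 0] with n hn
    have hn' : (0 : ℝ) < n := Nat.cast_pos.2 hn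
    calc (n : ℝ)⁻¹ * (n / m : ℕ) ≤ (n : ℝ)⁻¹ * (n / m) := by gcongr; exact Nat.cast_div_le
      _ = (m : ℝ)⁻¹ := by field_simp

/-- Block-uniform noise: a white process of variance at most `1` whose marginals have entropies
growing at a rate arbitrarily close to that of standard Gaussian noise. -/
theorem exists_whiteNoise {ε : ℝ} (hε : 0 < ε) :
    ∃ (P : Measure (ℕ → ℝ)) (_ : IsProbabilityMeasure P) (v r : ℝ) (lo hi : ℕ → ℝ),
      0 < v ∧ v ≤ 1 ∧ 1 / 2 * Real.log (2 * Real.pi * Real.exp 1) - ε < r ∧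
      Tendsto (fun n : ℕ => (n : ℝ)⁻¹ * lo n) atTop (nhds r) ∧
      Tendsto (fun n : ℕ => (n : ℝ)⁻¹ * hi n) atTop (nhds r) ∧
      (∀ k, MemLp (fun ω : ℕ → ℝ => ω k) 2 P) ∧
      (∀ k l, ∫ ω : ℕ → ℝ, ω k * ω l ∂P = if k = l then v else 0) ∧
      (∀ n, P.map (nvec n) ≤ ENNReal.ofReal (Real.exp (-lo n)) • volume) ∧
      (∀ n, ∃ S, MeasurableSet S ∧ P.map (nvec n) S = 1 ∧
        volume S ≤ ENNReal.ofReal (Real.exp (hi n))) := by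
  obtain ⟨k, hkε, hk⟩ := ((tendsto_log_volume_powerBall.eventually
    (lt_mem_nhds (sub_lt_self _ hε))).and (eventually_gt_atTop 0)).exists
  set m := 2 * k with hm
  have hm0 : 0 < m := by omega
  have : NeZero m := ⟨hm0.ne'⟩
  have hm' : (0 : ℝ) < m := Nat.cast_pos.2 hm0
  have hR : 0 < 2 * √(m : ℝ) := mul_pos two_pos (Real.sqrt_pos.2 hm')
  set V : ℝ := (2 * k) ^ k * Real.pi ^ k / k.factorial with hV
  have hVpos : 0 < V := by
    have : (0 : ℝ) < k := Nat.cast_pos.2 hk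
    have : (0 : ℝ) < k.factorial := Nat.cast_pos.2 k.factorial_pos
    positivity
  set θ : ℝ := (2 * √m)⁻¹ ^ m * V with hθ
  have hθpos : 0 < θ := by positivity
  have hθ' : uniformCube m m (powerBall m) = ENNReal.ofReal θ := by
    rw [uniformCube_powerBall, hm, volume_powerBall hk, ← hm, ← hV, hθ,
      ENNReal.ofReal_mul (p := (2 * √m)⁻¹ ^ m) (by positivity), ENNReal.ofReal_pow (by positivity),
      ENNReal.ofReal_inv_of_pos hR]
  have hlogθ : Real.log θ = Real.log V - m * Real.log (2 * √m) := by
    rw [hθ, Real.log_mul (by positivity) hVpos.ne', Real.log_pow, Real.log_inv]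
    ring
  have hexp : ∀ (x : ℝ) (_ : 0 < x) (n : ℕ), Real.exp (n * Real.log x) = x ^ n := by
    intro x hx n
    rw [Real.exp_nat_mul, Real.exp_log hx]
  have hlim : ∀ c : ℝ, Tendsto (fun n : ℕ => (n : ℝ)⁻¹ *
      (n * Real.log (2 * √m) + ((n / m : ℕ) + c) * Real.log θ)) atTop
      (nhds ((2 * k : ℝ)⁻¹ * Real.log V)) := by
    intro c
    have h1 := (tendsto_const_nhds (x := Real.log (2 * √m))).add
      (((tendsto_inv_mul_natCast_div hm0).add
        ((tendsto_inv_atTop_nhds_zero_nat (𝕜 := ℝ)).mul_const c)).mul_const (Real.log θ))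
    have h2 : Real.log (2 * √m) + ((m : ℝ)⁻¹ + 0 * c) * Real.log θ =
        (2 * k : ℝ)⁻¹ * Real.log V := by
      have : (2 * k : ℝ) = m := by rw [hm]; push_cast; ring
      rw [hlogθ, this]
      field_simp
      ring
    rw [h2] at h1
    refine h1.congr' ?_
    filter_upwards [eventually_gt_atTop 0] with n hn
    have hn' : (n : ℝ) ≠ 0 := (Nat.cast_pos.2 hn).ne'
    field_simp
  refine ⟨blockNoise m, inferInstance, ballVar m, (2 * k : ℝ)⁻¹ * Real.log V,
    fun n => n * Real.log (2 * √m) + ((n / m : ℕ) + 1) * Real.log θ,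
    fun n => n * Real.log (2 * √m) + ((n / m : ℕ) + 0) * Real.log θ,
    ballVar_pos m, ballVar_le_one m, hkε, hlim 1, hlim 0, memLp_blockNoise m,
    integral_mul_blockNoise m, fun n => ?_, fun n => ?_⟩
  · refine (map_nvec_blockNoise_le m (Q := n / m + 1)
      ((Nat.lt_mul_div_succ n hm0).le.trans_eq (Nat.mul_comm _ _))).trans_eq ?_
    congr 1
    beta_reduce
    have hcast : (((n / m : ℕ) : ℝ) + 1) = ((n / m + 1 : ℕ) : ℝ) := by push_cast; ring
    rw [hθ', hcast, neg_add, Real.exp_add, Real.exp_neg, Real.exp_neg, hexp _ hR, hexp _ hθpos,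
      mul_comm,
      ENNReal.ofReal_mul (p := ((2 * √m) ^ n)⁻¹) (by positivity),
      ENNReal.ofReal_inv_of_pos (by positivity),
      ENNReal.ofReal_inv_of_pos (by positivity), ENNReal.ofReal_pow hR.le,
      ENNReal.ofReal_pow hθpos.le, ENNReal.inv_pow, ENNReal.inv_pow]
  · obtain ⟨S, hS, hS1, hSv⟩ := exists_support_blockNoise m (Nat.div_mul_le_self n m)
    refine ⟨S, hS, hS1, hSv.trans_eq ?_⟩
    beta_reduce
    rw [hθ', add_zero, Real.exp_add, hexp _ hR, hexp _ hθpos,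
      ENNReal.ofReal_mul (p := (2 * √m) ^ n) (by positivity),
      ENNReal.ofReal_pow hR.le, ENNReal.ofReal_pow hθpos.le]

theorem exists_renyiRate_gt {p : ℕ} {a : ℕ → ℝ} (hpos : (toeplitz p a).PosDef)
    {α : ℝ} (hα : 1 < α) {ε : ℝ} (hε : 0 < ε) :
    ∃ (μ : Measure (ℕ → ℝ)) (_ : IsProbabilityMeasure μ)
      (F : (n : ℕ) → (Fin n → ℝ) → ℝ) (L : EReal),
      SatisfiesBurgConstraints μ p a ∧
      HasDensityFamilyNat μ F ∧
      HasRenyiRate F α L ∧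
      ((1 / 2 * Real.log (2 * Real.pi * Real.exp 1 * predVar p a) - ε : ℝ) : EReal) < L := by
  obtain ⟨P, hPprob, v, r, lo, hi, hv0, hv1, hr, hlo, hhi, hmem, hcov, hlow, hupp⟩ :=
    exists_whiteNoise hε
  obtain ⟨b, hb0, hbz, hb⟩ := exists_filterFamily hpos
  have hvar : ∀ q, q ≤ p → 0 < predVar q a := fun q hq =>
    predVar_pos (toeplitz_posDef_of_le hpos hq)
  set s : ℕ → ℝ := fun k => √(predVar (min k p) a / v) with hs
  have hquot : ∀ k, 0 < predVar (min k p) a / v := fun k =>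
    div_pos (hvar _ (min_le_right _ _)) hv0
  have hspos : ∀ k, 0 < s k := fun k => Real.sqrt_pos.2 (hquot k)
  have hs2 : ∀ k, s k ^ 2 * v = predVar (min k p) a := fun k => by
    rw [hs, Real.sq_sqrt (hquot k).le, div_mul_cancel₀ _ hv0.ne']
  obtain ⟨hm, hburg⟩ := satisfiesBurgConstraints_arSolution hb0 hbz hb hs2 hmem hcov
  obtain ⟨F, hF, hbounds⟩ := exists_densityFamily_arSolution hb0 hbz hspos hm hlow hupp hα
  have hsum : Tendsto (fun n : ℕ => (n : ℝ)⁻¹ * ∑ k ∈ Finset.range n, Real.log (s k)) atTop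
      (nhds (1 / 2 * Real.log (predVar p a / v))) := by
    refine (tendsto_inv_mul_sum_predVar p fun q => 1 / 2 * Real.log (predVar q a / v)).congr
      fun n => ?_
    congr 1
    refine Finset.sum_congr rfl fun k _ => ?_
    rw [hs, Real.log_sqrt (hquot k).le]
    ring
  refine ⟨_, Measure.isProbabilityMeasure_map hm.aemeasurable, F,
    ((r + 1 / 2 * Real.log (predVar p a / v) : ℝ) : EReal), hburg, hF, ?_, ?_⟩
  · have hlim : ∀ u : ℕ → ℝ, Tendsto (fun n : ℕ => (n : ℝ)⁻¹ * u n) atTop (nhds r) →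
        Tendsto (fun n : ℕ => (((n : ℝ)⁻¹ : ℝ) : EReal) *
          ((u n + ∑ k ∈ Finset.range n, Real.log (s k) : ℝ) : EReal)) atTop
          (nhds ((r + 1 / 2 * Real.log (predVar p a / v) : ℝ) : EReal)) := by
      intro u hu
      refine ((continuous_coe_real_ereal.tendsto _).comp (hu.add hsum)).congr fun n => ?_
      rw [Function.comp_apply, ← mul_add, EReal.coe_mul]
    have hnn : ∀ n : ℕ, (0 : EReal) ≤ (((n : ℝ)⁻¹ : ℝ) : EReal) := fun n =>
      EReal.coe_nonneg.2 (inv_nonneg.2 n.cast_nonneg)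
    exact tendsto_of_tendsto_of_tendsto_of_le_of_le (hlim lo hlo) (hlim hi hhi)
      (fun n => mul_le_mul_of_nonneg_left (hbounds n).1 (hnn n))
      (fun n => mul_le_mul_of_nonneg_left (hbounds n).2 (hnn n))
  · rw [EReal.coe_lt_coe_iff, Real.log_mul (by positivity) (hvar p le_rfl).ne',
      Real.log_div (hvar p le_rfl).ne' hv0.ne']
    have := Real.log_nonpos hv0.le hv1
    linarith

/-- Theorem 3, case `α > 1`: if the `(p+1)×(p+1)` Toeplitz matrix
`K_{p+1}` built from `α₀, …, α_p` is positive definite, `K_p` is its top-left `p×p`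
submatrix, `σ² = det K_{p+1} / det K_p`, and `α > 1`, then the supremum of the order-`α`
Rényi rate over all one-sided processes with `E[X_i X_{i+k}] = α_k` (`i ∈ ℕ`, `0 ≤ k ≤ p`)
whose Rényi rate is defined equals `½ log(2πeσ²)`, the Shannon entropy rate of the `p`-th
order Gauss–Markov process: every such rate is at most `½ log(2πeσ²)`, and for every
`ε > 0` some such process has rate exceeding `½ log(2πeσ²) - ε`. -/
theorem burg_renyi_rate_alpha_gt_one
    (p : ℕ) (a : ℕ → ℝ) (hpos : (toeplitz p a).PosDef)
    (α : ℝ) (hα : 1 < α) :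
    (∀ (μ : Measure (ℕ → ℝ)), IsProbabilityMeasure μ →
      ∀ (F : (n : ℕ) → (Fin n → ℝ) → ℝ) (L : EReal),
        SatisfiesBurgConstraints μ p a →
        HasDensityFamilyNat μ F →
        HasRenyiRate F α L →
        L ≤ ((1 / 2 * Real.log (2 * Real.pi * Real.exp 1 *
          ((toeplitz p a).det / (toeplitzSub p a).det)) : ℝ) : EReal)) ∧
    (∀ ε : ℝ, 0 < ε →
      ∃ (μ : Measure (ℕ → ℝ)) (_ : IsProbabilityMeasure μ)
        (F : (n : ℕ) → (Fin n → ℝ) → ℝ) (L : EReal),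
        SatisfiesBurgConstraints μ p a ∧
        HasDensityFamilyNat μ F ∧
        HasRenyiRate F α L ∧
        ((1 / 2 * Real.log (2 * Real.pi * Real.exp 1 *
          ((toeplitz p a).det / (toeplitzSub p a).det)) - ε : ℝ) : EReal) < L) := by
  exact ⟨fun μ hμ F L hB hF hL => renyiRate_le hpos hα hB hF hL,
    fun ε hε => exists_renyiRate_gt hpos hα hε⟩
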